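/- arXiv:2302.12553 — 6 statements merged into one kernel-verified Lean document; each statement's English description precedes it below -/
import Mathlib

section
/- For every natural number k, setting n = 2^k, the function f : R^n → R given by f(x) = max{0, x_1, ..., x_n} cannot be represented by any feedforward ReLU neural network with k hidden layers in which all weights and biases are integers (the width of the network may be arbitrary). -/
open Pointwise MeasureTheory

noncomputable section

/-- `IntReLUrep k n m f`: the function `f : ℝ^n → ℝ^m` is computed by a feedforward ReLU
neural network with `k` hidden layers in which all weights and biases are integers. -/
def IntReLUrep : ℕ → (n : ℕ) → (m : ℕ) → ((Fin n → ℝ) → (Fin m → ℝ)) → Prop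
  | 0, n, m, f => ∃ (A : Matrix (Fin m) (Fin n) ℤ) (b : Fin m → ℤ),
      ∀ x, f x = fun i => (∑ j, (A i j : ℝ) * x j) + (b i : ℝ)
  | k+1, n, m, f => ∃ (p : ℕ) (A : Matrix (Fin p) (Fin n) ℤ) (b : Fin p → ℤ)
      (g : (Fin p → ℝ) → (Fin m → ℝ)), IntReLUrep k p m g ∧
      ∀ x, f x = g (fun i => max 0 ((∑ j, (A i j : ℝ) * x j) + (b i : ℝ)))

/-- `ReLU^ℤ_n(k)`: real-valued functions on `ℝ^n` computable by an integral ReLU network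
with `k` hidden layers. -/
def IntReLU (n k : ℕ) (f : (Fin n → ℝ) → ℝ) : Prop :=
  ∃ F : (Fin n → ℝ) → (Fin 1 → ℝ), IntReLUrep k n 1 F ∧ ∀ x, f x = F x 0

/-- `maxZero x = max {0, x 1, …, x n}`. -/
def maxZero {n : ℕ} (x : Fin n → ℝ) : ℝ := Finset.univ.fold max 0 x

namespace RL

/-- Convex continuous functions, as an additive monoid. -/
def Mon (n : ℕ) : AddSubmonoid ((Fin n → ℝ) → ℝ) where
  carrier := {h | ConvexOn ℝ Set.univ h ∧ Continuous h}
  zero_mem' := ⟨convexOn_const 0 convex_univ, continuous_const⟩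
  add_mem' := fun ha hb => ⟨ha.1.add hb.1, ha.2.add hb.2⟩

/-- Integer points below a function. -/
def S {n : ℕ} (h : (Fin n → ℝ) → ℝ) : Set (Fin n → ℤ) :=
  {m | ∀ ξ, ∑ i, (m i : ℝ) * ξ i ≤ h ξ}

lemma S_finite {n : ℕ} (h : (Fin n → ℝ) → ℝ) : (S h).Finite := by
  apply Set.Finite.subset (Set.finite_Icc (fun i => ⌊-h (-Pi.single i 1)⌋ : Fin n → ℤ)
    (fun i => ⌈h (Pi.single i 1)⌉))
  intro m hm
  refine ⟨fun i => ?_, fun i => ?_⟩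
  · have h1 := hm (-Pi.single i 1)
    simp [Pi.single_apply] at h1
    have h2 : -h (-Pi.single i 1) ≤ m i := by linarith
    exact_mod_cast (Int.floor_le _).trans h2
  · have h1 := hm (Pi.single i 1)
    simp [Pi.single_apply] at h1
    exact_mod_cast h1.trans (Int.le_ceil _)

lemma key {n : ℕ} {r p q : (Fin n → ℝ) → ℝ} (hr : r ∈ Mon n) (hp : p ∈ Mon n) (hq : q ∈ Mon n) :
    (S (r + ((p ⊔ q) + (p ⊔ q)))).ncard + (S (r + (p + q))).ncard
      = (S (r + ((p ⊔ q) + p))).ncard + (S (r + ((p ⊔ q) + q))).ncard := by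
  have hU : S (r + ((p ⊔ q) + (p ⊔ q))) = S (r + ((p ⊔ q) + p)) ∪ S (r + ((p ⊔ q) + q)) := by
    ext m
    constructor
    · intro hm
      by_contra hc
      simp only [S, Set.mem_union, Set.mem_ofPred_eq, not_or, not_forall, not_le, Pi.add_apply,
        Pi.sup_apply] at hc hm
      obtain ⟨⟨a, ha⟩, ⟨b, hb⟩⟩ := hc
      have hma := hm a
      have hmb := hm b
      have hpa : p a < q a := by
        by_contra hle
        rw [sup_eq_left.2 (not_lt.1 hle)] at ha hma
        linarith
      have hpb : q b < p b := by
        by_contra hle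
        rw [sup_eq_right.2 (not_lt.1 hle)] at hb hmb
        linarith
      rw [sup_eq_right.2 hpa.le] at ha
      rw [sup_eq_left.2 hpb.le] at hb
      have hcont : ContinuousOn (fun t : ℝ => p ((1 - t) • a + t • b) - q ((1 - t) • a + t • b))
          (Set.Icc 0 1) := by
        have := hp.2
        have := hq.2
        fun_prop
      have hiv := intermediate_value_Icc (zero_le_one (α := ℝ)) hcont
      have h0 : (0 : ℝ) ∈ Set.Icc (p ((1 - (0:ℝ)) • a + (0:ℝ) • b) - q ((1 - (0:ℝ)) • a + (0:ℝ) • b))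
          (p ((1 - (1:ℝ)) • a + (1:ℝ) • b) - q ((1 - (1:ℝ)) • a + (1:ℝ) • b)) := by
        simp
        constructor <;> linarith
      obtain ⟨t, ⟨ht0, ht1⟩, ht⟩ := hiv h0
      have hm' := hm ((1 - t) • a + t • b)
      have hpq : p ((1 - t) • a + t • b) = q ((1 - t) • a + t • b) := by
        simpa [sub_eq_zero] using ht
      rw [← hpq, sup_idem] at hm'
      have hconv := ((hr.1.add hp.1).add hq.1).2 (Set.mem_univ a) (Set.mem_univ b)
        (sub_nonneg.2 ht1) ht0 (by ring)
      simp only [Pi.add_apply, smul_eq_mul] at hconv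
      rw [← hpq] at hconv
      have hlin : ∑ i, (m i : ℝ) * ((1 - t) • a + t • b) i
          = (1 - t) * ∑ i, (m i : ℝ) * a i + t * ∑ i, (m i : ℝ) * b i := by
        simp only [Finset.mul_sum, ← Finset.sum_add_distrib, Pi.add_apply, Pi.smul_apply,
          smul_eq_mul]
        exact Finset.sum_congr rfl fun i _ => by ring
      rw [hlin] at hm'
      rcases ht0.eq_or_lt with rfl | ht0'
      · simp at hpq; linarith
      · nlinarith [mul_nonneg (sub_nonneg.2 ht1) (sub_nonneg.2 ha.le),
          mul_pos ht0' (sub_pos.2 hb)]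
    · rintro (hm | hm) ξ
      · refine (hm ξ).trans ?_
        simp
      · refine (hm ξ).trans ?_
        simp
  have hI : S (r + (p + q)) = S (r + ((p ⊔ q) + p)) ∩ S (r + ((p ⊔ q) + q)) := by
    ext m
    constructor
    · intro hm
      refine ⟨fun ξ => (hm ξ).trans ?_, fun ξ => (hm ξ).trans ?_⟩
      · simp only [Pi.add_apply, Pi.sup_apply]
        linarith [le_sup_right (a := p ξ) (b := q ξ)]
      · simp only [Pi.add_apply, Pi.sup_apply]
        linarith [le_sup_left (a := p ξ) (b := q ξ)]
    · rintro ⟨h1, h2⟩ ξ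
      have h1 := h1 ξ
      have h2 := h2 ξ
      simp only [Pi.add_apply, Pi.sup_apply] at *
      rcases le_total (p ξ) (q ξ) with h | h
      · rw [sup_eq_right.2 h] at h1; linarith
      · rw [sup_eq_left.2 h] at h2; linarith
  rw [hU, hI, Set.ncard_union_add_ncard_inter _ _ (S_finite _) (S_finite _)]

/-- The linear form with integer coefficients. -/
def coordM {n : ℕ} (i : Fin n) : Mon n :=
  ⟨fun x => x i, (LinearMap.proj (R := ℝ) (φ := fun _ : Fin n => ℝ) i).convexOn convex_univ,
    continuous_apply i⟩

lemma S_coord {n : ℕ} (r : (Fin n → ℝ) → ℝ) (j : Fin n) :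
    (S (r + fun x => x j)).ncard = (S r).ncard := by
  have : S (r + fun x => x j) = (fun m => m + Pi.single j 1) '' S r := by
    ext m
    constructor
    · intro hm
      refine ⟨m - Pi.single j 1, fun ξ => ?_, by simp⟩
      have := hm ξ
      simp [sub_mul, Finset.sum_sub_distrib, Pi.single_apply] at this ⊢
      linarith
    · rintro ⟨m, hm, rfl⟩ ξ
      have := hm ξ
      simp [add_mul, Finset.sum_add_distrib, Pi.single_apply] at this ⊢
      linarith
  rw [this, Set.ncard_image_of_injective _ (add_left_injective _)]

/-- The algebra. -/
abbrev R (n : ℕ) := AddMonoidAlgebra (ZMod 2) (Mon n)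

/-- Counting functional. -/
def N (n : ℕ) : R n →+ ZMod 2 :=
  (Finsupp.linearCombination (ZMod 2)
    (fun h : Mon n => ((S h.1).ncard : ZMod 2))).toAddMonoidHom.comp
    (AddMonoidAlgebra.coeffAddEquiv (R := ZMod 2) (M := Mon n)).toAddMonoidHom

lemma N_single {n : ℕ} (h : Mon n) (c : ZMod 2) :
    N n (AddMonoidAlgebra.single h c) = c * ((S h.1).ncard : ZMod 2) := by
  simp [N]

/-- The kernel ideal. -/
def I (n : ℕ) : Ideal (R n) where
  carrier := {a | ∀ b, N n (b * a) = 0}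
  zero_mem' := by simp
  add_mem' := by
    intro a b ha hb c
    rw [mul_add, map_add, ha, hb, add_zero]
  smul_mem' := by
    intro c a ha b
    rw [smul_eq_mul, ← mul_assoc]
    exact ha _

/-- The quotient. -/
abbrev B (n : ℕ) := R n ⧸ I n

/-- Exponential. -/
def e {n : ℕ} (h : Mon n) : B n := Ideal.Quotient.mk (I n) (AddMonoidAlgebra.single h 1)

lemma e_add {n : ℕ} (h h' : Mon n) : e (h + h') = e h * e h' := by
  simp [e, ← map_mul, AddMonoidAlgebra.single_mul_single]

lemma e_zero {n : ℕ} : e (0 : Mon n) = 1 := by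
  rw [e, ← AddMonoidAlgebra.one_def, map_one]

lemma mem_I {n : ℕ} (a : R n)
    (h : ∀ r : Mon n, N n (AddMonoidAlgebra.single r 1 * a) = 0) : a ∈ I n := by
  intro b
  induction b using AddMonoidAlgebra.induction_linear with
  | zero => simp
  | add x y hx hy => rw [add_mul, map_add, hx, hy, add_zero]
  | single r c =>
    have hc : c = 0 ∨ c = 1 := by revert c; decide
    rcases hc with rfl | rfl
    · simp
    · exact h r

lemma two_B {n : ℕ} : (2 : B n) = 0 := by
  have : (2 : R n) = 0 := by
    have h2 : (2 : ZMod 2) = 0 := by decide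
    have := congrArg (algebraMap (ZMod 2) (R n)) h2
    rwa [map_ofNat, map_zero] at this
  have h := congrArg (Ideal.Quotient.mk (I n)) this
  rwa [map_ofNat, map_zero] at h

/-- The maximum. -/
def sup {n : ℕ} (p q : Mon n) : Mon n :=
  ⟨p.1 ⊔ q.1, p.2.1.sup q.2.1, p.2.2.sup q.2.2⟩

lemma e_coord {n : ℕ} (i : Fin n) : e (coordM i) = 1 := by
  rw [← e_zero, e, e, Ideal.Quotient.eq]
  apply mem_I
  intro r
  rw [mul_sub, map_sub, AddMonoidAlgebra.single_mul_single, AddMonoidAlgebra.single_mul_single,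
    N_single, N_single, sub_eq_zero]
  congr 2
  rw [add_zero]
  exact S_coord r.1 i

lemma e_sup {n : ℕ} (p q : Mon n) : (e (sup p q) - e p) * (e (sup p q) - e q) = 0 := by
  have h1 : (e (sup p q) - e p) * (e (sup p q) - e q)
    = e (sup p q + sup p q) + e (p + q) - e (sup p q + p) - e (sup p q + q) := by
    simp only [e_add]; ring
  rw [h1]
  simp only [e, ← map_add, ← map_sub]
  rw [Ideal.Quotient.eq_zero_iff_mem]
  apply mem_I
  intro r
  simp only [mul_sub, mul_add, map_sub, map_add, AddMonoidAlgebra.single_mul_single, N_single,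
    one_mul]
  have := congrArg (Nat.cast : ℕ → ZMod 2) (key r.2 p.2 q.2)
  push_cast at this
  rw [sub_sub, sub_eq_zero]
  exact this

lemma frob {n : ℕ} (x y : B n) (j : ℕ) : (x - y) ^ 2 ^ j = x ^ 2 ^ j - y ^ 2 ^ j := by
  induction j with
  | zero => simp
  | succ j ih =>
    rw [pow_succ, pow_mul, pow_mul, pow_mul, ih]
    linear_combination (y ^ 2 ^ j * y ^ 2 ^ j - x ^ 2 ^ j * y ^ 2 ^ j) * two_B (n := n)

lemma step {n : ℕ} (p q : Mon n) (j : ℕ) (h : e p ^ 2 ^ j = e q ^ 2 ^ j) :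
    e (sup p q) ^ 2 ^ (j + 1) = e q ^ 2 ^ (j + 1) := by
  have h0 := e_sup p q
  have hr : ∀ r, (e (sup p q) - e q) ^ (r + 1) = (e (sup p q) - e q) * (e p - e q) ^ r := by
    intro r
    induction r with
    | zero => simp
    | succ r ih =>
      rw [pow_succ, ih]
      linear_combination (e p - e q) ^ r * h0
  have h1 : (e (sup p q) - e q) ^ (2 ^ j + 1) = 0 := by
    rw [hr, frob, h, sub_self, mul_zero]
  have h2 : (e (sup p q) - e q) ^ 2 ^ (j + 1) = 0 := by
    apply pow_eq_zero_of_le _ h1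
    have := Nat.one_le_two_pow (n := j)
    rw [pow_succ]; omega
  rw [frob] at h2
  exact sub_eq_zero.1 h2

open Filter Topology in
/-- Functions whose recession function is good at level `j`. -/
def Good (n j : ℕ) : AddSubgroup ((Fin n → ℝ) → ℝ) where
  carrier := {f | ∃ p q : Mon n,
    (∀ x, Tendsto (fun t : ℝ => f (t • x) / t) atTop (𝓝 (p.1 x - q.1 x))) ∧
    e p ^ 2 ^ j = e q ^ 2 ^ j ∧ IsUnit (e p) ∧ IsUnit (e q)}
  zero_mem' := ⟨0, 0, by simp, rfl, by simp [e_zero], by simp [e_zero]⟩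
  add_mem' := by
    rintro f g ⟨p, q, h1, h2, h3, h4⟩ ⟨p', q', h1', h2', h3', h4'⟩
    refine ⟨p + p', q + q', fun x => ?_, ?_, ?_, ?_⟩
    · convert (h1 x).add (h1' x) using 2
      · simp [add_div]
      · simp; ring
    · rw [e_add, e_add, mul_pow, mul_pow, h2, h2']
    · rw [e_add]; exact h3.mul h3'
    · rw [e_add]; exact h4.mul h4'
  neg_mem' := by
    rintro f ⟨p, q, h1, h2, h3, h4⟩
    refine ⟨q, p, fun x => ?_, h2.symm, h4, h3⟩
    convert (h1 x).neg using 2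
    · simp [neg_div]
    · ring

lemma good_const {n j : ℕ} (c : ℝ) : (fun _ => c) ∈ Good n j := by
  refine ⟨0, 0, fun x => ?_, rfl, by simp [e_zero], by simp [e_zero]⟩
  simpa using Filter.tendsto_id.const_div_atTop c

lemma good_coord {n : ℕ} (i : Fin n) : (fun x => x i) ∈ Good n 0 := by
  refine ⟨coordM i, 0, fun x => ?_, by simp [e_zero, e_coord], by simp [e_coord], by simp [e_zero]⟩
  apply tendsto_const_nhds.congr'
  filter_upwards [Filter.eventually_gt_atTop 0] with t ht
  simp [coordM]
  field_simp

lemma good_relu {n j : ℕ} {f : (Fin n → ℝ) → ℝ} (hf : f ∈ Good n j) :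
    (fun x => max 0 (f x)) ∈ Good n (j + 1) := by
  obtain ⟨p, q, h1, h2, h3, h4⟩ := hf
  have hs := step p q j h2
  refine ⟨sup p q, q, fun x => ?_, hs, ?_, h4⟩
  · have h := (tendsto_const_nhds (x := (0:ℝ))).max (h1 x)
    have he : (sup p q).1 x - q.1 x = max 0 (p.1 x - q.1 x) := by
      simp only [sup, Pi.sup_apply]
      rw [← max_sub_sub_right, sub_self, max_comm]
    rw [he]
    apply h.congr'
    filter_upwards [Filter.eventually_gt_atTop 0] with t ht
    rw [← max_div_div_right ht.le, zero_div]
  · have : IsUnit (e (sup p q) ^ 2 ^ (j + 1)) := by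
      rw [hs]; exact h4.pow _
    exact (isUnit_pow_iff (by positivity)).1 this

lemma good_affine {n j p : ℕ} (a : Fin p → ℤ) (b : ℤ) (h : Fin p → (Fin n → ℝ) → ℝ)
    (hh : ∀ i, h i ∈ Good n j) :
    (fun x => (∑ i, (a i : ℝ) * h i x) + (b : ℝ)) ∈ Good n j := by
  have : (fun x => (∑ i, (a i : ℝ) * h i x) + (b : ℝ)) = (∑ i, a i • h i) + fun _ => (b : ℝ) := by
    ext x; simp
  rw [this]
  exact add_mem (sum_mem fun i _ => zsmul_mem (hh i) _) (good_const _)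

lemma good_net {n : ℕ} : ∀ (k j p m : ℕ) (g : (Fin p → ℝ) → (Fin m → ℝ)), IntReLUrep k p m g →
    ∀ (h : Fin p → (Fin n → ℝ) → ℝ), (∀ i, h i ∈ Good n j) →
    ∀ l, (fun x => g (fun i => h i x) l) ∈ Good n (j + k)
  | 0, j, p, m, g, hg, h, hh, l => by
    obtain ⟨A, b, hg⟩ := hg
    simp only [hg]
    exact good_affine (A l) (b l) h hh
  | k+1, j, p, m, g, hg, h, hh, l => by
    obtain ⟨p', A, b, g', hg', hg⟩ := hg
    simp only [hg]
    have := good_net k (j+1) p' m g' hg' (fun i x => max 0 ((∑ t, (A i t : ℝ) * h t x) + (b i : ℝ)))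
      (fun i => good_relu (good_affine (A i) (b i) h hh)) l
    rw [show j + (k + 1) = j + 1 + k by ring]
    exact this

lemma maxZero_le {n : ℕ} (x : Fin n → ℝ) (c : ℝ) : maxZero x ≤ c ↔ 0 ≤ c ∧ ∀ i, x i ≤ c := by
  simp [maxZero, Finset.fold_max_le]

lemma maxZero_nonneg {n : ℕ} (x : Fin n → ℝ) : 0 ≤ maxZero x := ((maxZero_le x _).1 le_rfl).1
lemma le_maxZero {n : ℕ} (x : Fin n → ℝ) (i : Fin n) : x i ≤ maxZero x :=
  ((maxZero_le x _).1 le_rfl).2 i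

lemma maxZero_smul {n : ℕ} (x : Fin n → ℝ) (t : ℝ) (ht : 0 < t) :
    maxZero (t • x) = t * maxZero x := by
  apply le_antisymm
  · rw [maxZero_le]
    refine ⟨mul_nonneg ht.le (maxZero_nonneg x), fun i => ?_⟩
    exact mul_le_mul_of_nonneg_left (le_maxZero x i) ht.le
  · rw [← le_div_iff₀' ht, maxZero_le]
    refine ⟨div_nonneg (maxZero_nonneg _) ht.le, fun i => ?_⟩
    rw [le_div_iff₀' ht]
    exact le_maxZero (t • x) i

lemma maxZero_mem (n : ℕ) : (maxZero : (Fin n → ℝ) → ℝ) ∈ Mon n := by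
  refine ⟨⟨convex_univ, ?_⟩, ?_⟩
  · intro x _ y _ a b ha hb hab
    rw [maxZero_le]
    refine ⟨add_nonneg (mul_nonneg ha (maxZero_nonneg x)) (mul_nonneg hb (maxZero_nonneg y)),
      fun i => ?_⟩
    exact add_le_add (mul_le_mul_of_nonneg_left (le_maxZero x i) ha)
      (mul_le_mul_of_nonneg_left (le_maxZero y i) hb)
  · have : ∀ s : Finset (Fin n), Continuous (fun x : Fin n → ℝ => s.fold max 0 x) := by
      intro s
      induction s using Finset.induction_on with
      | empty => simpa using continuous_const
      | insert a s ha ih =>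
        simp only [Finset.fold_insert ha]
        exact (continuous_apply a).max ih
    exact this Finset.univ

lemma mem_S_max {n : ℕ} (hn : 0 < n) (m : Fin n → ℤ) :
    m ∈ S (fun x : Fin n → ℝ => (n : ℝ) * maxZero x) ↔ (∀ i, 0 ≤ m i) ∧ ∑ i, m i ≤ n := by
  constructor
  · intro hm
    constructor
    · intro i
      have h1 := hm (-Pi.single i 1)
      have h2 : maxZero (-Pi.single i 1 : Fin n → ℝ) ≤ 0 := by
        rw [maxZero_le]
        refine ⟨le_rfl, fun j => ?_⟩
        simp [Pi.single_apply]
        split_ifs <;> norm_num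
      have h3 : maxZero (-Pi.single i 1 : Fin n → ℝ) = 0 := le_antisymm h2 (maxZero_nonneg _)
      simp only [h3] at h1
      simp [Pi.single_apply] at h1
      exact h1
    · have h1 := hm (fun _ => 1)
      have h2 : maxZero (fun _ => 1 : Fin n → ℝ) ≤ 1 := by
        rw [maxZero_le]; simp
      have h3 : (n : ℝ) * maxZero (fun _ => 1 : Fin n → ℝ) ≤ n * 1 := by gcongr
      have h4 := h1.trans h3
      simp only [mul_one] at h4
      exact_mod_cast h4
  · rintro ⟨h0, h1⟩ ξ
    calc ∑ i, (m i : ℝ) * ξ i ≤ ∑ i, (m i : ℝ) * maxZero ξ :=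
          Finset.sum_le_sum fun i _ => mul_le_mul_of_nonneg_left (le_maxZero ξ i)
            (by exact_mod_cast h0 i)
      _ = ((∑ i, m i : ℤ) : ℝ) * maxZero ξ := by rw [← Finset.sum_mul]; push_cast; rfl
      _ ≤ n * maxZero ξ := mul_le_mul_of_nonneg_right (by exact_mod_cast h1) (maxZero_nonneg ξ)

lemma card_S_max {n : ℕ} (hn : 0 < n) :
    (S (fun x : Fin n → ℝ => (n : ℝ) * maxZero x)).ncard = Nat.centralBinom n := by
  let E : {P : Fin (n+1) → ℕ // ∑ i, P i = n} ≃ S (fun x : Fin n → ℝ => (n : ℝ) * maxZero x) :=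
    { toFun := fun P => ⟨fun i => (P.1 i.succ : ℤ), by
        rw [mem_S_max hn]
        refine ⟨fun i => by positivity, ?_⟩
        have := P.2
        rw [Fin.sum_univ_succ] at this
        exact_mod_cast (by omega : ∑ i : Fin n, P.1 i.succ ≤ n)⟩
      invFun := fun m => ⟨Fin.cons (n - ∑ i, (m.1 i).toNat) (fun i => (m.1 i).toNat), by
        have := (mem_S_max hn m.1).1 m.2
        rw [Fin.sum_univ_succ]
        simp only [Fin.cons_zero, Fin.cons_succ]
        have h : ∑ i, (m.1 i).toNat ≤ n := by
          zify
          rw [Finset.sum_congr rfl fun i _ => Int.toNat_of_nonneg (this.1 i)]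
          exact this.2
        omega⟩
      left_inv := by
        rintro ⟨P, hP⟩
        apply Subtype.ext
        ext i
        rw [Fin.sum_univ_succ] at hP
        refine Fin.cases ?_ (fun i => ?_) i
        · simp; omega
        · simp
      right_inv := by
        rintro ⟨m, hm⟩
        apply Subtype.ext
        ext i
        simpa using ((mem_S_max hn m).1 hm).1 i }
  rw [← Nat.card_coe_set_eq, ← Nat.card_congr E,
    ← Nat.card_congr (Sym.equivNatSumOfFintype (Fin (n+1)) n), Nat.card_eq_fintype_card,
    Sym.card_sym_eq_choose, Fintype.card_fin, Nat.centralBinom]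
  congr 1
  omega

lemma card_S_zero {n : ℕ} : (S (0 : (Fin n → ℝ) → ℝ)).ncard = 1 := by
  rw [Set.ncard_eq_one]
  refine ⟨0, ?_⟩
  ext m
  constructor
  · intro hm
    ext i
    have h1 := hm (Pi.single i 1)
    have h2 := hm (-Pi.single i 1)
    simp [Pi.single_apply] at h1 h2
    exact le_antisymm h1 h2
  · rintro rfl ξ
    simp

lemma e_nsmul {n : ℕ} (h : Mon n) (c : ℕ) : e (c • h) = e h ^ c := by
  induction c with
  | zero => simp [e_zero]
  | succ c ih => rw [succ_nsmul, e_add, ih, pow_succ]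

end RL

/-- For `n = 2^k`, the function `max {0, x_1, …, x_n}` is not computable by an
integral ReLU neural network with `k` hidden layers (of arbitrary width). -/
theorem max_not_representable_with_k_hidden_layers (k : ℕ) :
    ¬ IntReLU (2 ^ k) k (fun x => maxZero x) := by
  rintro ⟨F, hF, hf⟩
  have hG := RL.good_net k 0 _ 1 F hF (fun i x => x i) (fun i => RL.good_coord i) 0
  obtain ⟨p, q, h1, h2, h3, h4⟩ := hG
  rw [zero_add] at h2
  have hpq : p = q + ⟨maxZero, RL.maxZero_mem _⟩ := by
    apply Subtype.ext
    ext x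
    have ht : Filter.Tendsto (fun t : ℝ => F (t • x) 0 / t) Filter.atTop (nhds (maxZero x)) := by
      apply tendsto_const_nhds.congr'
      filter_upwards [Filter.eventually_gt_atTop 0] with t ht
      rw [← hf]
      show maxZero x = maxZero (t • x) / t
      rw [RL.maxZero_smul x t ht]
      field_simp
    have := tendsto_nhds_unique (h1 x) ht
    simp only [AddSubmonoid.coe_add, Pi.add_apply]
    linarith
  rw [hpq, RL.e_add, mul_pow] at h2
  have h5 : RL.e (⟨maxZero, RL.maxZero_mem (2 ^ k)⟩ : RL.Mon (2 ^ k)) ^ 2 ^ k = 1 := by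
    apply (h4.pow (2 ^ k)).mul_left_cancel
    rw [h2, mul_one]
  rw [← RL.e_nsmul, ← RL.e_zero, RL.e, RL.e, Ideal.Quotient.eq] at h5
  have h6 := h5 1
  rw [one_mul, map_sub, RL.N_single, RL.N_single, one_mul, one_mul, sub_eq_zero] at h6
  have h7 : ((2 ^ k • (⟨maxZero, RL.maxZero_mem (2 ^ k)⟩ : RL.Mon (2 ^ k)) : RL.Mon (2 ^ k)) :
      (Fin (2 ^ k) → ℝ) → ℝ) = fun x => ((2 ^ k : ℕ) : ℝ) * maxZero x := by
    ext x
    simp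
  rw [h7, RL.card_S_max (by positivity)] at h6
  have h8 : ((Nat.centralBinom (2 ^ k) : ℕ) : ZMod 2) = 0 :=
    (ZMod.natCast_eq_zero_iff _ _).2 (Nat.two_dvd_centralBinom_of_one_le (by positivity))
  rw [h8, AddSubmonoid.coe_zero, RL.card_S_zero] at h6
  exact absurd h6 (by decide)

end
end

section
/- For all natural numbers n and k with 1 ≤ k ≤ ⌈log₂(n+1)⌉, the inclusion ReLU^Z_n(k-1) ⊆ ReLU^Z_n(k) is strict: there exists a function R^n → R that is computable by an integral ReLU network with k hidden layers but not by any integral ReLU network with k−1 hidden layers. -/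
open Pointwise MeasureTheory

noncomputable section

namespace SDH

open AddMonoidAlgebra in
def Nhat {V : Type*} (N : V → ZMod 2) : AddMonoidAlgebra (ZMod 2) V →ₗ[ZMod 2] ZMod 2 :=
  (Finsupp.linearCombination (ZMod 2) N) ∘ₗ
    (AddMonoidAlgebra.coeffLinearEquiv (R := ZMod 2) (S := ZMod 2) (M := V)).toLinearMap

lemma Nhat_single {V : Type*} (N : V → ZMod 2) (v : V) :
    Nhat N (AddMonoidAlgebra.single v 1) = N v := by
  simp [Nhat]

def kerIdeal {V : Type*} [AddCommMonoid V] (N : V → ZMod 2) :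
    Ideal (AddMonoidAlgebra (ZMod 2) V) where
  carrier := {r | ∀ s, Nhat N (r * s) = 0}
  add_mem' := by
    intro a b ha hb s
    rw [add_mul, map_add, ha s, hb s, add_zero]
  zero_mem' := by intro s; simp
  smul_mem' := by
    intro c x hx s
    have := hx (c * s)
    rw [smul_eq_mul, mul_comm c x, mul_assoc]; exact this

lemma mem_kerIdeal {V : Type*} [AddCommMonoid V] (N : V → ZMod 2)
    (r : AddMonoidAlgebra (ZMod 2) V)
    (h : ∀ w, Nhat N (r * AddMonoidAlgebra.single w 1) = 0) : r ∈ kerIdeal N := by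
  intro s
  induction s using AddMonoidAlgebra.induction_on with
  | of a => exact h _
  | add x y hx hy => rw [mul_add, map_add, hx, hy, add_zero]
  | smul c x hx => rw [mul_smul_comm, map_smul, hx, smul_zero]

abbrev QR {V : Type*} [AddCommMonoid V] (N : V → ZMod 2) :=
  AddMonoidAlgebra (ZMod 2) V ⧸ kerIdeal N

def ee {V : Type*} [AddCommMonoid V] (N : V → ZMod 2) (v : V) : QR N :=
  Ideal.Quotient.mk _ (AddMonoidAlgebra.single v 1)

section
variable {V : Type*} [AddCommMonoid V] (N : V → ZMod 2)

lemma ee_add (v w : V) : ee N (v + w) = ee N v * ee N w := by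
  unfold ee
  rw [← map_mul, AddMonoidAlgebra.single_mul_single, one_mul]

lemma ee_zero : ee N (0 : V) = 1 := by
  unfold ee
  rw [← AddMonoidAlgebra.one_def, map_one]

lemma ee_nsmul (k : ℕ) (v : V) : ee N (k • v) = ee N v ^ k := by
  induction k with
  | zero => simp [ee_zero]
  | succ k ih => rw [succ_nsmul, ee_add, ih, pow_succ]

lemma two_eq : (2 : QR N) = 0 := by
  have h : (2 : AddMonoidAlgebra (ZMod 2) V) = 0 := by
    have : (2 : ZMod 2) = 0 := rfl
    rw [← map_ofNat (algebraMap (ZMod 2) (AddMonoidAlgebra (ZMod 2) V)) 2, this, map_zero]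
  rw [← map_ofNat (Ideal.Quotient.mk (kerIdeal N)) 2, h, map_zero]

lemma N_eq_of_ee (v w : V) (h : ee N v = ee N w) : N v = N w := by
  unfold ee at h
  rw [Ideal.Quotient.eq] at h
  have := h 1
  rw [mul_one, map_sub, Nhat_single, Nhat_single, sub_eq_zero] at this
  exact this

lemma ee_eq (v w : V) (h : ∀ u, N (v + u) = N (w + u)) : ee N v = ee N w := by
  unfold ee
  rw [Ideal.Quotient.eq]
  apply mem_kerIdeal
  intro u
  rw [sub_mul, AddMonoidAlgebra.single_mul_single, AddMonoidAlgebra.single_mul_single, one_mul,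
    map_sub, Nhat_single, Nhat_single, h, sub_self]

lemma ee_rel (M g h : V)
    (H : ∀ w, N (M + M + w) + N (g + h + w) + N (M + g + w) + N (M + h + w) = 0) :
    (ee N M + ee N g) * (ee N M + ee N h) = 0 := by
  unfold ee
  rw [← map_add, ← map_add, ← map_mul, Ideal.Quotient.eq_zero_iff_mem]
  apply mem_kerIdeal
  intro w
  simp only [add_mul, mul_add, AddMonoidAlgebra.single_mul_single, one_mul, map_add, Nhat_single]
  rw [← H w, add_comm g M]
  ring
end

lemma frob {A : Type*} [CommRing A] (h2 : (2 : A) = 0) (a b : A) (k : ℕ) :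
    (a + b) ^ (2 ^ k) = a ^ (2 ^ k) + b ^ (2 ^ k) := by
  induction k with
  | zero => simp
  | succ k ih =>
    rw [pow_succ, pow_mul, ih, pow_mul, pow_mul]
    linear_combination (a ^ (2 ^ k) * b ^ (2 ^ k)) * h2

lemma key {A : Type*} [CommRing A] (h2 : (2 : A) = 0) (a b c : A) (k : ℕ)
    (h : (a + b) * (a + c) = 0) (hbc : b ^ (2 ^ k) = c ^ (2 ^ k)) :
    a ^ (2 ^ (k+1)) = c ^ (2 ^ (k+1)) := by
  have h1 : (a + b) ^ (2 ^ k) * (a + c) ^ (2 ^ k) = 0 := by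
    rw [← mul_pow, h, zero_pow (by positivity)]
  rw [frob h2, frob h2, hbc] at h1
  rw [pow_succ, pow_mul, pow_mul]
  linear_combination h1 - (a ^ (2 ^ k) * c ^ (2 ^ k) + (c ^ (2 ^ k)) ^ 2) * h2

/-- continuous sublinear functions -/
def VV (n : ℕ) : AddSubmonoid ((Fin n → ℝ) → ℝ) where
  carrier := {f | Continuous f ∧ ConvexOn ℝ Set.univ f ∧ ∀ c : ℝ, 0 ≤ c → ∀ x, f (c • x) = c * f x}
  add_mem' := by
    rintro a b ⟨h1, h2, h3⟩ ⟨h1', h2', h3'⟩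
    refine ⟨h1.add h1', h2.add h2', fun c hc x => ?_⟩
    simp only [Pi.add_apply, h3 c hc, h3' c hc]; ring
  zero_mem' := ⟨continuous_const, convexOn_const 0 convex_univ, by simp⟩

def lin {n : ℕ} (m : Fin n → ℤ) (x : Fin n → ℝ) : ℝ := ∑ i, (m i : ℝ) * x i

lemma lin_smul {n : ℕ} (m : Fin n → ℤ) (c : ℝ) (x : Fin n → ℝ) : lin m (c • x) = c * lin m x := by
  simp only [lin, Pi.smul_apply, smul_eq_mul, Finset.mul_sum]
  exact Finset.sum_congr rfl fun i _ => by ring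

lemma lin_add {n : ℕ} (m : Fin n → ℤ) (x y : Fin n → ℝ) : lin m (x + y) = lin m x + lin m y := by
  simp only [lin, Pi.add_apply, mul_add, Finset.sum_add_distrib]

lemma lin_add_left {n : ℕ} (m m' : Fin n → ℤ) (x : Fin n → ℝ) :
    lin (m + m') x = lin m x + lin m' x := by
  simp only [lin, Pi.add_apply, Int.cast_add, add_mul, Finset.sum_add_distrib]

lemma lin_continuous {n : ℕ} (m : Fin n → ℤ) : Continuous (lin m) := by
  unfold lin; fun_prop

lemma lin_mem {n : ℕ} (m : Fin n → ℤ) : lin m ∈ VV n := by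
  refine ⟨lin_continuous m, ⟨convex_univ, ?_⟩, fun c _ x => lin_smul m c x⟩
  intro x _ y _ a b _ _ _
  rw [lin_add, lin_smul, lin_smul]; simp

lemma max_mem {n : ℕ} {f g : (Fin n → ℝ) → ℝ} (hf : f ∈ VV n) (hg : g ∈ VV n) :
    (fun x => max (f x) (g x)) ∈ VV n := by
  obtain ⟨h1, h2, h3⟩ := hf
  obtain ⟨h1', h2', h3'⟩ := hg
  refine ⟨h1.max h1', h2.sup h2', fun c hc x => ?_⟩
  simp only [h3 c hc, h3' c hc]
  rw [mul_max_of_nonneg _ _ hc]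

def SS {n : ℕ} (f : (Fin n → ℝ) → ℝ) : Set (Fin n → ℤ) := {m | ∀ x, lin m x ≤ f x}

lemma lin_single {n : ℕ} (m : Fin n → ℤ) (i : Fin n) (c : ℝ) :
    lin m (Pi.single i c) = m i * c := by
  simp [lin, Pi.single_apply]

lemma SS_finite {n : ℕ} (f : (Fin n → ℝ) → ℝ) : (SS f).Finite := by
  apply (Set.finite_Icc (fun i => -⌊f (Pi.single i (-1))⌋) (fun i => ⌊f (Pi.single i 1)⌋)).subset
  intro m hm
  refine ⟨fun i => ?_, fun i => ?_⟩
  · have := hm (Pi.single i (-1))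
    rw [lin_single] at this
    have h : -m i ≤ ⌊f (Pi.single i (-1))⌋ := by
      rw [Int.le_floor]; push_cast; linarith
    simp only; linarith
  · have := hm (Pi.single i 1)
    rw [lin_single] at this
    rw [Int.le_floor]; linarith

lemma SS_inter {n : ℕ} (a b : (Fin n → ℝ) → ℝ) :
    SS a ∩ SS b = SS (fun x => min (a x) (b x)) := by
  ext m
  simp only [SS, Set.mem_inter_iff, Set.mem_ofPred_eq, le_min_iff, forall_and]

lemma SS_union {n : ℕ} (a b : (Fin n → ℝ) → ℝ) (ha : a ∈ VV n) (hb : b ∈ VV n)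
    (hab : (fun x => min (a x) (b x)) ∈ VV n) :
    SS a ∪ SS b = SS (fun x => max (a x) (b x)) := by
  ext m
  simp only [SS, Set.mem_union, Set.mem_ofPred_eq, le_max_iff]
  constructor
  · rintro (h | h) x
    · exact Or.inl (h x)
    · exact Or.inr (h x)
  · intro h
    by_contra! hc
    obtain ⟨⟨x, hx⟩, ⟨y, hy⟩⟩ := hc
    have hconv : Convex ℝ {z | min (a z) (b z) < lin m z} := by
      intro x hx y hy s t hs ht hst
      have h1 := hab.2.1.2 (Set.mem_univ x) (Set.mem_univ y) hs ht hst
      simp only [Set.mem_ofPred_eq, smul_eq_mul] at *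
      rw [lin_add, lin_smul, lin_smul]
      refine lt_of_le_of_lt h1 ?_
      rcases hs.eq_or_lt with rfl | hs
      · have : t = 1 := by linarith
        subst this; simpa using hy
      · have := mul_lt_mul_of_pos_left hx hs
        have := mul_le_mul_of_nonneg_left hy.le ht
        linarith
    have hp := hconv.isPreconnected
    have := hp {z | a z < lin m z} {z | b z < lin m z}
      (isOpen_lt ha.1 (lin_continuous m)) (isOpen_lt hb.1 (lin_continuous m))
      (fun z hz => by simpa using hz) ⟨x, by simp [hx], hx⟩ ⟨y, by simp [hy], hy⟩
    obtain ⟨z, _, hz1, hz2⟩ := this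
    simp only [Set.mem_ofPred_eq] at hz1 hz2
    rcases h z with h | h <;> linarith

def NN {n : ℕ} (f : VV n) : ZMod 2 := ((SS (f : (Fin n → ℝ) → ℝ)).ncard : ZMod 2)

lemma NN_lin {n : ℕ} (m : Fin n → ℤ) (u : VV n) : NN (⟨lin m, lin_mem m⟩ + u) = NN (0 + u) := by
  unfold NN
  congr 1
  have : SS ((⟨lin m, lin_mem m⟩ + u : VV n) : (Fin n → ℝ) → ℝ) =
      (fun k => m + k) '' SS (u : (Fin n → ℝ) → ℝ) := by
    ext k
    simp only [SS, Set.mem_image, Set.mem_ofPred_eq, AddSubmonoid.coe_add, Pi.add_apply]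
    constructor
    · intro h
      refine ⟨k - m, fun x => ?_, by abel⟩
      have h1 := lin_add_left (k - m) m x
      rw [sub_add_cancel] at h1
      linarith [h x]
    · rintro ⟨k, h, rfl⟩ x
      rw [lin_add_left]; linarith [h x]
  rw [this, Set.ncard_image_of_injective _ (add_right_injective m), zero_add]

lemma NN_rel {n : ℕ} (g h w : VV n) :
    NN ((⟨_, max_mem g.2 h.2⟩ : VV n) + ⟨_, max_mem g.2 h.2⟩ + w) + NN (g + h + w) +
    NN ((⟨_, max_mem g.2 h.2⟩ : VV n) + g + w) + NN ((⟨_, max_mem g.2 h.2⟩ : VV n) + h + w) = 0 := by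
  set M : VV n := ⟨_, max_mem g.2 h.2⟩ with hM
  have hMx : ∀ x, (M : (Fin n → ℝ) → ℝ) x =
    max ((g : (Fin n → ℝ) → ℝ) x) ((h : (Fin n → ℝ) → ℝ) x) := fun x => rfl
  have hmin : (fun x => min (((M + g + w : VV n) : (Fin n → ℝ) → ℝ) x)
     (((M + h + w : VV n) : (Fin n → ℝ) → ℝ) x)) = ((g + h + w : VV n) : (Fin n → ℝ) → ℝ) := by
    ext x
    simp only [AddSubmonoid.coe_add, Pi.add_apply, hMx]
    rcases le_total ((g : (Fin n → ℝ) → ℝ) x) ((h : (Fin n → ℝ) → ℝ) x) with hh | hh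
    · rw [max_eq_right hh, min_eq_left (by linarith)]; ring
    · rw [max_eq_left hh, min_eq_right (by linarith)]
  have hmax : (fun x => max (((M + g + w : VV n) : (Fin n → ℝ) → ℝ) x)
     (((M + h + w : VV n) : (Fin n → ℝ) → ℝ) x)) = ((M + M + w : VV n) : (Fin n → ℝ) → ℝ) := by
    ext x
    simp only [AddSubmonoid.coe_add, Pi.add_apply, hMx]
    rcases le_total ((g : (Fin n → ℝ) → ℝ) x) ((h : (Fin n → ℝ) → ℝ) x) with hh | hh
    · rw [max_eq_right hh, max_eq_right (by linarith)]
    · rw [max_eq_left hh, max_eq_left (by linarith)]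
  have hu := SS_union _ _ (M + g + w).2 (M + h + w).2 (by rw [hmin]; exact (g + h + w).2)
  have hi := SS_inter ((M + g + w : VV n) : (Fin n → ℝ) → ℝ) ((M + h + w : VV n) : (Fin n → ℝ) → ℝ)
  have hc := Set.ncard_union_add_ncard_inter _ _
    (SS_finite ((M + g + w : VV n) : (Fin n → ℝ) → ℝ))
    (SS_finite ((M + h + w : VV n) : (Fin n → ℝ) → ℝ))
  rw [hu, hi, hmin, hmax] at hc
  unfold NN
  have h2 := congrArg (Nat.cast : ℕ → ZMod 2) hc
  rw [Nat.cast_add, Nat.cast_add] at h2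
  rw [h2, add_assoc]
  exact CharTwo.add_self_eq_zero _

abbrev E {n : ℕ} (f : VV n) : QR (NN (n := n)) := ee NN f

/-- the invariant -/
def PP {n : ℕ} (k : ℕ) (f : (Fin n → ℝ) → ℝ) : Prop :=
  ∃ g h : VV n, IsUnit (E g) ∧ IsUnit (E h) ∧ E g ^ (2 ^ k) = E h ^ (2 ^ k) ∧
    ∃ C : ℝ, ∀ x, |f x - (g.1 x - h.1 x)| ≤ C

lemma E_lin {n : ℕ} (m : Fin n → ℤ) : E (⟨lin m, lin_mem m⟩ : VV n) = 1 := by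
  rw [← ee_zero NN]
  exact ee_eq _ _ _ (NN_lin m)

lemma PP_const {n : ℕ} (k : ℕ) (c : ℝ) : PP k (fun _ : Fin n → ℝ => c) :=
  ⟨0, 0, by simp [E, ee_zero], by simp [E, ee_zero], rfl, |c|, fun x => by simp⟩

lemma PP_lin {n : ℕ} (m : Fin n → ℤ) : PP 0 (lin m) :=
  ⟨⟨lin m, lin_mem m⟩, 0, by simp [E_lin], by simp [E, ee_zero], by simp [E_lin]; simp [E, ee_zero],
    0, fun x => by simp⟩

lemma PP_add {n : ℕ} {k : ℕ} {f f' : (Fin n → ℝ) → ℝ} (hf : PP k f) (hf' : PP k f') :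
    PP k (fun x => f x + f' x) := by
  obtain ⟨g, h, h1, h2, h3, C, h4⟩ := hf
  obtain ⟨g', h', h1', h2', h3', C', h4'⟩ := hf'
  refine ⟨g + g', h + h', ?_, ?_, ?_, C + C', fun x => ?_⟩
  · simp only [E, ee_add]; exact h1.mul h1'
  · simp only [E, ee_add]; exact h2.mul h2'
  · simp only [E, ee_add, mul_pow] at *; rw [h3, h3']
  · have := abs_add_le (f x - (g.1 x - h.1 x)) (f' x - (g'.1 x - h'.1 x))
    have e : f x + f' x - ((g + g').1 x - (h + h').1 x) =
      (f x - (g.1 x - h.1 x)) + (f' x - (g'.1 x - h'.1 x)) := by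
      simp only [AddSubmonoid.coe_add, Pi.add_apply]; ring
    rw [e]; linarith [h4 x, h4' x]

lemma PP_neg {n : ℕ} {k : ℕ} {f : (Fin n → ℝ) → ℝ} (hf : PP k f) :
    PP k (fun x => - f x) := by
  obtain ⟨g, h, h1, h2, h3, C, h4⟩ := hf
  refine ⟨h, g, h2, h1, h3.symm, C, fun x => ?_⟩
  rw [← abs_neg]; convert h4 x using 2; ring

lemma PP_int {n : ℕ} {k : ℕ} {f : (Fin n → ℝ) → ℝ} (hf : PP k f) (c : ℤ) :
    PP k (fun x => (c : ℝ) * f x) := by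
  have hN : ∀ c : ℕ, PP k (fun x => (c : ℝ) * f x) := by
    intro c
    induction c with
    | zero => simpa using PP_const k 0
    | succ c ih =>
      convert PP_add ih hf using 2
      push_cast; ring
  obtain ⟨c, rfl | rfl⟩ := c.eq_nat_or_neg
  · simpa using hN c
  · simpa using PP_neg (hN c)

lemma PP_sum {n : ℕ} {k : ℕ} {ι : Type*} (s : Finset ι) (f : ι → (Fin n → ℝ) → ℝ)
    (hf : ∀ i, PP k (f i)) : PP k (fun x => ∑ i ∈ s, f i x) := by
  classical
  induction s using Finset.induction_on with
  | empty => simpa using PP_const k 0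
  | insert a s ha ih =>
    simp only [Finset.sum_insert ha]
    exact PP_add (hf a) ih

lemma PP_relu {n : ℕ} {k : ℕ} {f : (Fin n → ℝ) → ℝ} (hf : PP k f) :
    PP (k + 1) (fun x => max 0 (f x)) := by
  obtain ⟨g, h, h1, h2, h3, C, h4⟩ := hf
  have hk := key (two_eq _) _ _ _ k (ee_rel NN _ _ _ (NN_rel g h)) h3
  refine ⟨⟨_, max_mem g.2 h.2⟩, h, ?_, h2, hk, C, fun x => ?_⟩
  · rw [← isUnit_pow_iff (n := 2 ^ (k+1)) (by positivity)]
    unfold E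
    rw [hk]; exact h2.pow _
  · have e : max (g.1 x) (h.1 x) - h.1 x = max 0 (g.1 x - h.1 x) := by
      rw [← max_sub_sub_right, sub_self, max_comm]
    simp only
    rw [e]
    refine le_trans ?_ (h4 x)
    rw [max_comm 0, max_comm 0]
    exact abs_max_sub_max_le_abs _ _ _

lemma PP_rep (k : ℕ) : ∀ (a n p m : ℕ) (g : (Fin p → ℝ) → (Fin m → ℝ)), IntReLUrep k p m g →
    ∀ u : (Fin n → ℝ) → (Fin p → ℝ), (∀ i, PP a (fun x => u x i)) →
    ∀ i, PP (a + k) (fun x => g (u x) i) := by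
  induction k with
  | zero =>
    rintro a n p m g ⟨A, b, hg⟩ u hu i
    simp only [hg]
    exact PP_add (PP_sum _ _ fun j => PP_int (hu j) _) (PP_const _ _)
  | succ k ih =>
    rintro a n p m f ⟨q, A, b, g, hgr, hg⟩ u hu i
    simp only [hg]
    have := ih (a + 1) n q m g hgr
      (fun x i => max 0 ((∑ j, (A i j : ℝ) * u x j) + (b i : ℝ))) (fun i => ?_) i
    · rwa [add_assoc, add_comm 1 k] at this
    · exact PP_relu (PP_add (PP_sum _ _ fun j => PP_int (hu j) _) (PP_const _ _))

lemma PP_of_IntReLU {n k : ℕ} {f : (Fin n → ℝ) → ℝ} (h : IntReLU n k f) : PP k f := by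
  obtain ⟨F, hF, hf⟩ := h
  have := PP_rep k 0 n n 1 F hF id (fun i => ?_) 0
  · rw [zero_add] at this
    convert this using 2 with x
    exact hf x
  · convert PP_lin (Pi.single i 1 : Fin n → ℤ) using 2 with x
    simp [lin, Pi.single_apply]

lemma N_of_IntReLU {n k : ℕ} (f : VV n) (h : IntReLU n k f.1) : NN ((2 ^ k) • f) = 1 := by
  obtain ⟨g, h, h1, h2, h3, C, h4⟩ := PP_of_IntReLU h
  have hfg : f + h = g := by
    ext x
    by_contra hne
    have hne' : f.1 x - (g.1 x - h.1 x) ≠ 0 := by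
      intro h0; apply hne; simp only [AddSubmonoid.coe_add, Pi.add_apply]; linarith
    have hpos : 0 < |f.1 x - (g.1 x - h.1 x)| := abs_pos.mpr hne'
    obtain ⟨N, hN⟩ := exists_nat_gt (C / |f.1 x - (g.1 x - h.1 x)|)
    rw [div_lt_iff₀ hpos] at hN
    have hb := h4 ((N : ℝ) • x)
    rw [f.2.2.2 _ (Nat.cast_nonneg N), g.2.2.2 _ (Nat.cast_nonneg N),
      h.2.2.2 _ (Nat.cast_nonneg N)] at hb
    rw [← mul_sub, ← mul_sub, abs_mul, Nat.abs_cast] at hb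
    linarith
  have e1 : E f ^ (2 ^ k) = 1 := by
    rw [← hfg] at h3
    simp only [E, ee_add, mul_pow] at h3
    have hu := h2.pow (2 ^ k)
    apply hu.mul_right_cancel
    rw [one_mul]; exact h3
  have e2 : ee NN ((2 ^ k) • f) = ee NN (0 : VV n) := by
    rw [ee_nsmul, ee_zero]; exact e1
  rw [N_eq_of_ee _ _ _ e2]
  have : SS ((0 : VV n) : (Fin n → ℝ) → ℝ) = {0} := by
    ext m
    simp only [SS, Set.mem_ofPred_eq, Set.mem_singleton_iff, AddSubmonoid.coe_zero, Pi.zero_apply]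
    constructor
    · intro h
      ext i
      have a1 := h (Pi.single i 1)
      have a2 := h (Pi.single i (-1))
      rw [lin_single] at a1 a2
      have : (m i : ℝ) = 0 := by linarith
      exact_mod_cast this
    · rintro rfl x; simp [lin]
  unfold NN
  rw [this]; simp

def MX : (j : ℕ) → ((Fin j → Bool) → ℝ) → ℝ
  | 0, v => v default
  | j+1, v => MX j (fun b => max (v (Fin.cons true b)) (v (Fin.cons false b)))

lemma le_MX (j : ℕ) : ∀ (v : (Fin j → Bool) → ℝ) (b : Fin j → Bool), v b ≤ MX j v := by
  induction j with
  | zero => intro v b; rw [Subsingleton.elim b default]; rfl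
  | succ j ih =>
    intro v b
    refine le_trans ?_ (ih _ (Fin.tail b))
    rcases hb : b 0 with _ | _
    · refine le_trans (le_of_eq ?_) (le_max_right _ _)
      rw [← hb, Fin.cons_self_tail]
    · refine le_trans (le_of_eq ?_) (le_max_left _ _)
      rw [← hb, Fin.cons_self_tail]

lemma MX_le (j : ℕ) : ∀ (v : (Fin j → Bool) → ℝ) (c : ℝ), (∀ b, v b ≤ c) → MX j v ≤ c := by
  induction j with
  | zero => intro v c h; exact h _
  | succ j ih => intro v c h; exact ih _ _ fun b => max_le (h _) (h _)

lemma MX_mem {n : ℕ} (j : ℕ) : ∀ (v : (Fin j → Bool) → (Fin n → ℝ) → ℝ), (∀ b, v b ∈ VV n) →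
    (fun x => MX j (fun b => v b x)) ∈ VV n := by
  induction j with
  | zero => intro v h; exact h _
  | succ j ih =>
    intro v h
    exact ih (fun b x => max (v (Fin.cons true b) x) (v (Fin.cons false b) x))
      fun b => max_mem (h _) (h _)

lemma rep_max (j : ℕ) : ∀ (n : ℕ) (A : (Fin j → Bool) → Fin n → ℤ),
    IntReLUrep (j+1) n 1 (fun x _ => max 0 (MX j (fun b => lin (A b) x))) := by
  induction j with
  | zero =>
    intro n A
    refine ⟨1, fun _ => A default, 0, id, ⟨1, 0, fun x => ?_⟩, fun x => ?_⟩
    · ext i; obtain rfl := Subsingleton.elim i 0; simp [Matrix.one_apply]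
    · ext i; simp [MX, lin]
  | succ j ih =>
    intro n A
    let e := Fintype.equivFin (Fin 3 × (Fin j → Bool))
    let A1 : Fin 3 × (Fin j → Bool) → Fin n → ℤ := fun r =>
      ![A (Fin.cons true r.2) - A (Fin.cons false r.2), A (Fin.cons false r.2),
        - A (Fin.cons false r.2)] r.1
    let A2 : (Fin j → Bool) → Fin (Fintype.card (Fin 3 × (Fin j → Bool))) → ℤ := fun b r =>
      if (e.symm r).2 = b then ![1, 1, -1] (e.symm r).1 else 0
    refine ⟨_, fun r => A1 (e.symm r), 0, _, ih _ A2, fun x => ?_⟩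
    ext _
    simp only [MX]
    congr 2
    ext b
    have h1 : ∀ z : Fin (Fintype.card (Fin 3 × (Fin j → Bool))) → ℝ,
        lin (A2 b) z = z (e (0, b)) + z (e (1, b)) - z (e (2, b)) := by
      intro z
      unfold lin
      rw [← Equiv.sum_comp e, Fintype.sum_prod_type, Fin.sum_univ_three]
      simp [A2]
      ring
    have h2 : lin (A (Fin.cons true b) - A (Fin.cons false b)) x =
        lin (A (Fin.cons true b)) x - lin (A (Fin.cons false b)) x := by
      simp only [lin, Pi.sub_apply, Int.cast_sub, sub_mul, Finset.sum_sub_distrib]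
    have h3 : lin (-A (Fin.cons false b)) x = - lin (A (Fin.cons false b)) x := by
      simp [lin]
    rw [h1]
    simp only [Equiv.symm_apply_apply, A1, Pi.zero_apply, Int.cast_zero, add_zero]
    change _ = max 0 (lin (A (Fin.cons true b) - A (Fin.cons false b)) x) +
      max 0 (lin (A (Fin.cons false b)) x) - max 0 (lin (-A (Fin.cons false b)) x)
    rw [h2, h3]
    generalize lin (A (Fin.cons true b)) x = s
    generalize lin (A (Fin.cons false b)) x = t
    rcases le_total s t with h | h <;> rcases le_total 0 t with h' | h'
    · rw [max_eq_right h, max_eq_left (by linarith), max_eq_right h', max_eq_left (by linarith)]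
      ring
    · rw [max_eq_right h, max_eq_left (by linarith), max_eq_left h', max_eq_right (by linarith)]
      ring
    · rw [max_eq_left h, max_eq_right (by linarith), max_eq_right h', max_eq_left (by linarith)]
      ring
    · rw [max_eq_left h, max_eq_right (by linarith), max_eq_left h', max_eq_right (by linarith)]
      ring

def tf {n : ℕ} (j : ℕ) (ι : (Fin j → Bool) ↪ Fin n) : VV n :=
  ⟨fun x => max 0 (MX j (fun b => lin (Pi.single (ι b) 1) x)),
    max_mem (f := 0) (VV n).zero_mem (MX_mem j _ fun b => lin_mem _)⟩

lemma tf_IntReLU {n : ℕ} (j : ℕ) (ι : (Fin j → Bool) ↪ Fin n) : IntReLU n (j+1) (tf j ι).1 :=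
  ⟨_, rep_max j n (fun b => Pi.single (ι b) 1), fun _ => rfl⟩

lemma lin_single_left {n : ℕ} (i : Fin n) (x : Fin n → ℝ) : lin (Pi.single i 1) x = x i := by
  simp [lin, Pi.single_apply]

lemma tf_le {n : ℕ} (j : ℕ) (ι : (Fin j → Bool) ↪ Fin n) (x : Fin n → ℝ) (c : ℝ) (hc : 0 ≤ c)
    (h : ∀ b, x (ι b) ≤ c) : (tf j ι).1 x ≤ c :=
  max_le hc (MX_le _ _ _ fun b => by rw [lin_single_left]; exact h b)

lemma le_tf {n : ℕ} (j : ℕ) (ι : (Fin j → Bool) ↪ Fin n) (x : Fin n → ℝ) (b : Fin j → Bool) :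
    x (ι b) ≤ (tf j ι).1 x := by
  refine le_trans ?_ (le_max_right _ _)
  refine le_trans (le_of_eq ?_) (le_MX j _ b)
  rw [lin_single_left]

lemma tf_nonneg {n : ℕ} (j : ℕ) (ι : (Fin j → Bool) ↪ Fin n) (x : Fin n → ℝ) :
    0 ≤ (tf j ι).1 x := le_max_left _ _

def cm {n : ℕ} (j q : ℕ) (ι : (Fin j → Bool) ↪ Fin n)
    (P : {P : Option (Fin j → Bool) → ℕ // ∑ i, P i = q}) : Fin n → ℤ :=
  Function.extend ι (fun b => (P.1 (some b) : ℤ)) 0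

lemma cm_inj {n : ℕ} (j q : ℕ) (ι : (Fin j → Bool) ↪ Fin n) : Function.Injective (cm j q ι) := by
  intro P Q h
  have hs : ∀ b, P.1 (some b) = Q.1 (some b) := by
    intro b
    have := congrFun h (ι b)
    simp only [cm, ι.injective.extend_apply] at this
    exact_mod_cast this
  have hP := P.2
  have hQ := Q.2
  rw [Fintype.sum_option] at hP hQ
  simp only [hs] at hP
  ext o
  rcases o with _ | b
  · omega
  · exact hs b

lemma SS_tf {n : ℕ} (j q : ℕ) (ι : (Fin j → Bool) ↪ Fin n) :
    SS ((q • tf j ι : VV n) : (Fin n → ℝ) → ℝ) = Set.range (cm j q ι) := by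
  have hv : ∀ x, ((q • tf j ι : VV n) : (Fin n → ℝ) → ℝ) x = q * (tf j ι).1 x := by
    intro x; simp
  ext m
  simp only [SS, Set.mem_ofPred_eq, Set.mem_range, hv]
  constructor
  · intro h
    have h0 : ∀ i, 0 ≤ m i := by
      intro i
      have h1 := h (Pi.single i (-1))
      rw [lin_single] at h1
      have h2 := tf_le j ι (Pi.single i (-1)) 0 le_rfl (fun b => by
        rw [Pi.single_apply]; split_ifs <;> norm_num)
      have h3 := mul_nonneg (Nat.cast_nonneg (α := ℝ) q) (sub_nonneg.2 h2)
      have : (0 : ℝ) ≤ m i := by linarith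
      exact_mod_cast this
    have h1 : ∀ i, i ∉ Set.range ι → m i = 0 := by
      intro i hi
      have h1 := h (Pi.single i 1)
      rw [lin_single] at h1
      have h2 := tf_le j ι (Pi.single i 1) 0 le_rfl (fun b => by
        rw [Pi.single_apply, if_neg]
        rintro rfl; exact hi ⟨b, rfl⟩)
      have h3 := mul_nonneg (Nat.cast_nonneg (α := ℝ) q) (sub_nonneg.2 h2)
      have : (m i : ℝ) ≤ 0 := by linarith
      exact le_antisymm (by exact_mod_cast this) (h0 i)
    have hsum : ∑ b, m (ι b) = ∑ i, m i :=
      Fintype.sum_of_injective ι ι.injective _ _ h1 fun _ => rfl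
    have h2 : ∑ b, m (ι b) ≤ q := by
      rw [hsum]
      have h1 := h (fun _ => 1)
      have h2 := tf_le j ι (fun _ => 1) 1 zero_le_one (fun b => le_rfl)
      have h3 := mul_nonneg (Nat.cast_nonneg (α := ℝ) q) (sub_nonneg.2 h2)
      have h4 : lin m (fun _ => 1) = ((∑ i, m i : ℤ) : ℝ) := by simp [lin]
      rw [h4] at h1
      have : ((∑ i, m i : ℤ) : ℝ) ≤ q := by linarith
      exact_mod_cast this
    have h3 : ((∑ b, (m (ι b)).toNat : ℕ) : ℤ) = ∑ b, m (ι b) := by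
      push_cast
      exact Finset.sum_congr rfl fun b _ => Int.toNat_of_nonneg (h0 _)
    refine ⟨⟨fun o => o.elim (q - ∑ b, (m (ι b)).toNat) (fun b => (m (ι b)).toNat), ?_⟩, ?_⟩
    · rw [Fintype.sum_option]
      simp only [Option.elim]
      omega
    · ext i
      by_cases hi : i ∈ Set.range ι
      · obtain ⟨b, rfl⟩ := hi
        simp only [cm, ι.injective.extend_apply, Option.elim]
        exact Int.toNat_of_nonneg (h0 _)
      · simp only [cm]
        rw [Function.extend_apply' _ _ _ hi, h1 i hi]; rfl
  · rintro ⟨P, rfl⟩ x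
    have hl : ∑ b, (P.1 (some b) : ℝ) * x (ι b) = lin (cm j q ι P) x := by
      refine Fintype.sum_of_injective ι ι.injective _ _ ?_ ?_
      · intro i hi
        simp only [cm]
        rw [Function.extend_apply' _ _ _ hi]; simp
      · intro b
        simp only [cm, ι.injective.extend_apply]
        simp
    rw [← hl]
    have h1 : ∑ b, (P.1 (some b) : ℝ) * x (ι b) ≤ ∑ b, (P.1 (some b) : ℝ) * (tf j ι).1 x :=
      Finset.sum_le_sum fun b _ => mul_le_mul_of_nonneg_left (le_tf j ι x b) (Nat.cast_nonneg _)
    refine h1.trans ?_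
    rw [← Finset.sum_mul]
    refine mul_le_mul_of_nonneg_right ?_ (tf_nonneg j ι x)
    have hP := P.2
    rw [Fintype.sum_option] at hP
    have : ∑ b, P.1 (some b) ≤ q := by omega
    exact_mod_cast this

lemma NN_tf {n : ℕ} (j : ℕ) (ι : (Fin j → Bool) ↪ Fin n) : NN ((2 ^ j) • tf j ι) = 0 := by
  unfold NN
  rw [SS_tf, ← Set.image_univ, Set.ncard_image_of_injective _ (cm_inj _ _ _), Set.ncard_univ,
    ← Nat.card_congr (Sym.equivNatSumOfFintype (Option (Fin j → Bool)) (2 ^ j))]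
  classical
  rw [Nat.card_eq_fintype_card, Sym.card_sym_eq_choose]
  have : Fintype.card (Option (Fin j → Bool)) + 2 ^ j - 1 = 2 * 2 ^ j := by
    simp; omega
  rw [this, ← Nat.centralBinom_eq_two_mul_choose, ZMod.natCast_eq_zero_iff]
  exact Nat.two_dvd_centralBinom_of_one_le (by positivity)

end SDH

/-- For `1 ≤ k ≤ ⌈log₂ (n+1)⌉`, the inclusion `ReLU^ℤ_n(k-1) ⊆ ReLU^ℤ_n(k)` is strict. -/
theorem strict_depth_hierarchy (n k : ℕ) (hk : 1 ≤ k) (hk' : k ≤ Nat.clog 2 (n + 1)) :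
    ∃ f : (Fin n → ℝ) → ℝ, IntReLU n k f ∧ ¬ IntReLU n (k - 1) f := by
  obtain ⟨j, rfl⟩ : ∃ j, k = j + 1 := ⟨k - 1, by omega⟩
  have hj : 2 ^ j ≤ n := Nat.lt_succ_iff.1 (Nat.pow_lt_of_lt_clog hk')
  have hc : Fintype.card (Fin j → Bool) ≤ Fintype.card (Fin n) := by simpa using hj
  obtain ⟨ι⟩ := Function.Embedding.nonempty_of_card_le hc
  refine ⟨(SDH.tf j ι).1, SDH.tf_IntReLU j ι, fun h => ?_⟩
  have h1 := SDH.N_of_IntReLU _ h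
  rw [Nat.add_sub_cancel, SDH.NN_tf] at h1
  exact zero_ne_one h1

end
end

section
/- Let P, Q ⊂ R^n be lattice polytopes with i = dim(P) and j = dim(Q). If dim(P + Q) = dim(P) + dim(Q) (where + denotes Minkowski sum), then the integer binom(i+j, i) · Vol(P) · Vol(Q) divides Vol(P + Q). -/
open Pointwise MeasureTheory

noncomputable section

/-- Standard dot product on `Fin n → ℝ`. -/
def dotR {n : ℕ} (c x : Fin n → ℝ) : ℝ := ∑ i, c i * x i

/-- The set of minimizers of the linear functional `x ↦ cᵀx` over `P`. -/
def argminSet {n : ℕ} (c : Fin n → ℝ) (P : Set (Fin n → ℝ)) : Set (Fin n → ℝ) :=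
  {x ∈ P | ∀ y ∈ P, dotR c x ≤ dotR c y}

/-- A polytope: the convex hull of a nonempty finite set of points. -/
def IsPolytope {n : ℕ} (P : Set (Fin n → ℝ)) : Prop :=
  ∃ V : Finset (Fin n → ℝ), V.Nonempty ∧ P = convexHull ℝ (V : Set (Fin n → ℝ))

/-- A lattice polytope: the convex hull of a nonempty finite set of integral points. -/
def IsLatticePolytope {n : ℕ} (P : Set (Fin n → ℝ)) : Prop :=
  ∃ V : Finset (Fin n → ℤ), V.Nonempty ∧
    P = convexHull ℝ ((fun v (i : Fin n) => ((v i : ℤ) : ℝ)) '' (V : Set (Fin n → ℤ)))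

/-- `F` is a face of `P`: either the empty face or the set of minimizers of a
linear functional over `P`. -/
def IsFace {n : ℕ} (P F : Set (Fin n → ℝ)) : Prop :=
  F = ∅ ∨ ∃ c : Fin n → ℝ, F = argminSet c P

/-- The dimension of a set: the rank of the direction space of its affine span. -/
def polyDim {n : ℕ} (P : Set (Fin n → ℝ)) : ℕ :=
  Module.finrank ℝ (affineSpan ℝ P).direction

/-- A point all of whose coordinates are integers. -/
def IsIntPt {m : ℕ} (x : Fin m → ℝ) : Prop := ∀ i, ∃ z : ℤ, x i = (z : ℝ)

/-- An affine chart identifying the affine hull of `P` with `ℝ^r` and mapping the induced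
lattice of integral points bijectively onto `ℤ^r`. -/
def IsLatticeChart {n r : ℕ} (P : Set (Fin n → ℝ))
    (φ : (Fin n → ℝ) →ᵃ[ℝ] (Fin r → ℝ)) : Prop :=
  Set.BijOn (fun x => φ x) (affineSpan ℝ P : Set (Fin n → ℝ)) Set.univ ∧
  ∀ x ∈ affineSpan ℝ P, (IsIntPt x ↔ IsIntPt (φ x))

open Classical in
/-- The normalized volume of a (rational) polytope `P`: `r!` times the Euclidean volume of
the image of `P` under a lattice-preserving affine chart of its affine hull (`r = dim P`).
This is well defined (independent of the chart) and integral for lattice polytopes. -/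
def normVol {n : ℕ} (P : Set (Fin n → ℝ)) : ℝ :=
  (Nat.factorial (polyDim P)) *
    (if h : ∃ φ : (Fin n → ℝ) →ᵃ[ℝ] (Fin (polyDim P) → ℝ), IsLatticeChart P φ
      then (volume ((fun x => h.choose x) '' P)).toReal
      else 0)

/-- The normalized volume is an even integer. -/
def EvenVol {n : ℕ} (P : Set (Fin n → ℝ)) : Prop := ∃ m : ℤ, normVol P = 2 * (m : ℝ)

/-- The class `Q_k`: lattice polytopes all of whose faces of dimension at least `2^k`
have even normalized volume. -/
def InQclass (k : ℕ) {n : ℕ} (P : Set (Fin n → ℝ)) : Prop :=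
  IsLatticePolytope P ∧ ∀ F, IsFace P F → 2 ^ k ≤ polyDim F → EvenVol F

/-- The classes `P_k` of lattice polytopes dual to `k`-hidden-layer integral ReLU networks:
`P_0` consists of single lattice points, and `P_{k+1}` consists of finite Minkowski sums of
convex hulls of unions of pairs of polytopes from `P_k`. -/
def InPclass {n : ℕ} : ℕ → Set (Fin n → ℝ) → Prop
  | 0, P => ∃ v : Fin n → ℤ, P = {fun i => ((v i : ℤ) : ℝ)}
  | k+1, P => ∃ (l : ℕ) (Q : Fin l → Set (Fin n → ℝ)), 0 < l ∧
      (∀ i, ∃ Q₁ Q₂ : Set (Fin n → ℝ), InPclass k Q₁ ∧ InPclass k Q₂ ∧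
        Q i = convexHull ℝ (Q₁ ∪ Q₂)) ∧
      P = ∑ i, Q i

/-- A (polyhedral) subdivision of `R`: a finite collection of polytopes covering `R`,
any two of which intersect in a common face. -/
def IsSubdivision {n : ℕ} (R : Set (Fin n → ℝ)) (𝒞 : Finset (Set (Fin n → ℝ))) : Prop :=
  (∀ C ∈ 𝒞, IsPolytope C) ∧
  (⋃ C ∈ 𝒞, C) = R ∧
  ∀ C ∈ 𝒞, ∀ D ∈ 𝒞, IsFace C (C ∩ D) ∧ IsFace D (C ∩ D)

/-- The standard simplex `Δ^n_0 = conv{0, e_1, …, e_n} ⊆ ℝ^n`. -/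
def stdSimplexPoly (n : ℕ) : Set (Fin n → ℝ) :=
  convexHull ℝ ({0} ∪ Set.range (fun i : Fin n => fun j => if j = i then (1 : ℝ) else 0))

theorem isIntPt_add {m : ℕ} {x y : Fin m → ℝ} (hx : IsIntPt x) (hy : IsIntPt y) :
    IsIntPt (x + y) := by
  intro i
  obtain ⟨a, ha⟩ := hx i
  obtain ⟨b, hb⟩ := hy i
  exact ⟨a + b, by simp [ha, hb]⟩

theorem isIntPt_sub {m : ℕ} {x y : Fin m → ℝ} (hx : IsIntPt x) (hy : IsIntPt y) :
    IsIntPt (x - y) := by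
  intro i
  obtain ⟨a, ha⟩ := hx i
  obtain ⟨b, hb⟩ := hy i
  exact ⟨a - b, by simp [ha, hb]⟩

theorem mem_span_int_iff {m : ℕ} (x : Fin m → ℝ) :
    x ∈ Submodule.span ℤ (Set.range (Pi.basisFun ℝ (Fin m))) ↔ IsIntPt x := by
  rw [Module.Basis.mem_span_iff_repr_mem]
  simp [IsIntPt, eq_comm]

theorem exists_latticeChart {n : ℕ} (P : Set (Fin n → ℝ)) (hP : IsLatticePolytope P) :
    ∃ φ : (Fin n → ℝ) →ᵃ[ℝ] (Fin (polyDim P) → ℝ), IsLatticeChart P φ := by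
  obtain ⟨V, ⟨v0, hv0⟩, rfl⟩ := hP
  set W : Set (Fin n → ℝ) := (fun v (i : Fin n) => ((v i : ℤ) : ℝ)) '' (V : Set (Fin n → ℤ))
    with hW
  have hWint : ∀ w ∈ W, IsIntPt w := by
    rintro _ ⟨v, -, rfl⟩ i
    exact ⟨v i, rfl⟩
  set P := convexHull ℝ W with hPdef
  set p0 : Fin n → ℝ := fun i => ((v0 i : ℤ) : ℝ) with hp0
  have hp0W : p0 ∈ W := ⟨v0, hv0, rfl⟩
  have hp0int : IsIntPt p0 := hWint _ hp0W
  have haff : affineSpan ℝ P = affineSpan ℝ W := affineSpan_convexHull W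
  have hp0A : p0 ∈ affineSpan ℝ P := by
    rw [haff]; exact subset_affineSpan ℝ W hp0W
  set E : Submodule ℝ (Fin n → ℝ) := (affineSpan ℝ P).direction with hE
  let M : Submodule ℤ (Fin n → ℝ) := Submodule.span ℤ (Set.range (Pi.basisFun ℝ (Fin n)))
  let Λ : Submodule ℤ E := ZLattice.comap ℝ M E.subtype
  have hmemΛ : ∀ x : E, x ∈ Λ ↔ IsIntPt (x : Fin n → ℝ) := fun x => mem_span_int_iff _
  have : DiscreteTopology M := inferInstanceAs
    (DiscreteTopology (Submodule.span ℤ (Set.range (Pi.basisFun ℝ (Fin n)))))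
  have : DiscreteTopology Λ :=
    ZLattice.comap_discreteTopology ℝ M continuous_subtype_val Subtype.val_injective
  have : IsZLattice ℝ Λ := ⟨by
    rw [eq_top_iff]
    rintro ⟨x, hx⟩ -
    have hx' : x ∈ Submodule.span ℝ ((fun w => w - p0) '' W) := by
      have h2 : E = Submodule.span ℝ ((fun w => w - p0) '' W) := by
        rw [hE, haff, direction_affineSpan, vectorSpan_eq_span_vsub_set_right ℝ hp0W]
        rfl
      rw [← h2]; exact hx
    have hsub : Submodule.span ℝ ((fun w => w - p0) '' W) ≤
        (Submodule.span ℝ (Λ : Set E)).map E.subtype := by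
      rw [Submodule.span_le]
      rintro _ ⟨w, hw, rfl⟩
      have hwE : w - p0 ∈ E := by
        rw [hE]
        refine AffineSubspace.vsub_mem_direction ?_ hp0A
        rw [haff]; exact subset_affineSpan ℝ W hw
      refine ⟨⟨w - p0, hwE⟩, Submodule.subset_span ?_, rfl⟩
      exact (hmemΛ _).2 (isIntPt_sub (hWint w hw) hp0int)
    obtain ⟨y, hy, hyx⟩ := hsub hx'
    have : y = ⟨x, hx⟩ := Subtype.ext hyx
    rw [← this]; exact hy⟩
  have : Module.Finite ℤ Λ := ZLattice.module_finite ℝ Λ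
  have : Module.Free ℤ Λ := ZLattice.module_free ℝ Λ
  have hrank : Module.finrank ℤ Λ = polyDim P := ZLattice.rank ℝ Λ
  let b : Module.Basis (Fin (polyDim P)) ℤ Λ := Module.finBasisOfFinrankEq ℤ Λ hrank
  let B : Module.Basis (Fin (polyDim P)) ℝ E := b.ofZLatticeBasis ℝ Λ
  have hB : ∀ x : E, IsIntPt (x : Fin n → ℝ) ↔ IsIntPt (B.equivFun x) := by
    intro x
    rw [← hmemΛ, ← b.ofZLatticeBasis_span ℝ Λ, Module.Basis.mem_span_iff_repr_mem]
    simp [IsIntPt, eq_comm, B]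
  obtain ⟨f, hf⟩ := LinearMap.exists_extend (B.equivFun : E →ₗ[ℝ] (Fin (polyDim P) → ℝ))
  have hf' : ∀ x : E, f x = B.equivFun x := fun x => LinearMap.congr_fun hf x
  let φ : (Fin n → ℝ) →ᵃ[ℝ] (Fin (polyDim P) → ℝ) :=
    f.toAffineMap - AffineMap.const ℝ _ (f p0)
  have hφ : ∀ x, φ x = f (x - p0) := fun x => by simp [φ]
  have hφ' : ∀ x (hx : x ∈ affineSpan ℝ P),
      φ x = B.equivFun ⟨x - p0, AffineSubspace.vsub_mem_direction hx hp0A⟩ := fun x hx => by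
    rw [hφ, ← hf']
  refine ⟨φ, ⟨fun _ _ => trivial, ?_, ?_⟩, ?_⟩
  · intro x hx y hy hxy
    simp only at hxy
    rw [hφ' x hx, hφ' y hy] at hxy
    have := congrArg Subtype.val (B.equivFun.injective hxy)
    simpa using this
  · intro s _
    refine ⟨(B.equivFun.symm s : Fin n → ℝ) + p0, ?_, ?_⟩
    · exact AffineSubspace.vadd_mem_of_mem_direction (B.equivFun.symm s).2 hp0A
    · simp only [hφ, add_sub_cancel_right, hf', LinearEquiv.apply_symm_apply]
  · intro x hx
    rw [hφ' x hx, ← hB]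
    constructor
    · intro h; exact isIntPt_sub h hp0int
    · intro h; simpa using isIntPt_add h hp0int

theorem chart_inverse {n r : ℕ} (P : Set (Fin n → ℝ)) (hne : P.Nonempty)
    (φ : (Fin n → ℝ) →ᵃ[ℝ] (Fin r → ℝ)) (hφ : IsLatticeChart P φ) :
    ∃ g : (Fin r → ℝ) →ᵃ[ℝ] (Fin n → ℝ), (∀ s, g s ∈ affineSpan ℝ P) ∧
      (∀ x ∈ affineSpan ℝ P, g (φ x) = x) ∧ (∀ s, IsIntPt s → IsIntPt (g s)) := by
  obtain ⟨p0, hp0⟩ := hne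
  have hp0A : p0 ∈ affineSpan ℝ P := subset_affineSpan ℝ P hp0
  let f : (affineSpan ℝ P).direction →ₗ[ℝ] (Fin r → ℝ) :=
    φ.linear ∘ₗ (affineSpan ℝ P).direction.subtype
  have hfs : LinearMap.range f = ⊤ := by
    rw [LinearMap.range_eq_top]
    intro s
    obtain ⟨x, hx, hxs⟩ := hφ.1.surjOn (Set.mem_univ (s + φ p0))
    refine ⟨⟨x - p0, AffineSubspace.vsub_mem_direction hx hp0A⟩, ?_⟩
    simp only at hxs
    change φ.linear (x -ᵥ p0) = s
    rw [AffineMap.linearMap_vsub, hxs]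
    simp
  obtain ⟨h, hh⟩ := f.exists_rightInverse_of_surjective hfs
  have hh' : ∀ s, φ.linear (h s : Fin n → ℝ) = s := fun s => LinearMap.congr_fun hh s
  let k : (Fin r → ℝ) →ₗ[ℝ] (Fin n → ℝ) := (affineSpan ℝ P).direction.subtype ∘ₗ h
  let g : (Fin r → ℝ) →ᵃ[ℝ] (Fin n → ℝ) :=
    k.toAffineMap + AffineMap.const ℝ _ (p0 - k (φ p0))
  have hg : ∀ s, g s = (h (s - φ p0) : Fin n → ℝ) +ᵥ p0 := fun s => by
    simp [g, k]; abel
  have hgA : ∀ s, g s ∈ affineSpan ℝ P := fun s => by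
    rw [hg]; exact AffineSubspace.vadd_mem_of_mem_direction (h _).2 hp0A
  have hgr : ∀ s, φ (g s) = s := fun s => by
    rw [hg, AffineMap.map_vadd, hh']; simp
  refine ⟨g, hgA, fun x hx => hφ.1.injOn (hgA _) hx (hgr _), fun s hs => ?_⟩
  rw [hφ.2 _ (hgA s), hgr]; exact hs

theorem add_mem_affineSpan_add {n : ℕ} {P Q : Set (Fin n → ℝ)} {x y : Fin n → ℝ}
    (hx : x ∈ affineSpan ℝ P) (hy : y ∈ affineSpan ℝ Q) : x + y ∈ affineSpan ℝ (P + Q) := by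
  have h1 : ∀ q ∈ Q, x + q ∈ affineSpan ℝ (P + Q) := by
    intro q hq
    have : affineSpan ℝ P ≤ (affineSpan ℝ (P + Q)).comap
        (AffineMap.id ℝ (Fin n → ℝ) + AffineMap.const ℝ _ q) := by
      rw [affineSpan_le]
      intro p hp
      exact subset_affineSpan ℝ _ (Set.add_mem_add hp hq)
    exact this hx
  have : affineSpan ℝ Q ≤ (affineSpan ℝ (P + Q)).comap
      (AffineMap.const ℝ _ x + AffineMap.id ℝ (Fin n → ℝ)) := by
    rw [affineSpan_le]
    intro q hq
    exact h1 q hq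
  exact this hy

theorem volume_image_intAffine {d : ℕ} (T : (Fin d → ℝ) →ᵃ[ℝ] (Fin d → ℝ))
    (hT : ∀ x, IsIntPt x → IsIntPt (T x)) :
    ∃ z : ℤ, ∀ S : Set (Fin d → ℝ), (volume (T '' S)).toReal = (z : ℝ) * (volume S).toReal := by
  have hlin : ∀ i, IsIntPt (T.linear (Pi.single i 1)) := by
    intro i
    have : T.linear (Pi.single i 1) = T (Pi.single i 1) - T 0 := by
      have := T.linearMap_vsub (Pi.single i 1) 0
      simpa using this
    rw [this]
    refine isIntPt_sub (hT _ ?_) (hT _ ?_)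
    · intro j
      by_cases h : j = i
      · subst h; exact ⟨1, by simp⟩
      · exact ⟨0, by simp [h]⟩
    · intro j; exact ⟨0, by simp⟩
  choose A hA using hlin
  let N : Matrix (Fin d) (Fin d) ℤ := Matrix.of fun j i => A i j
  have hN : LinearMap.toMatrix' T.linear = N.map (Int.castRingHom ℝ) := by
    ext j i
    rw [LinearMap.toMatrix'_apply]
    have := hA i j
    simp only [N, Matrix.map_apply, Matrix.of_apply, eq_intCast]
    rw [← this]
  have hdet : LinearMap.det T.linear = (N.det : ℝ) := by
    rw [← LinearMap.det_toMatrix', hN]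
    exact (RingHom.map_det (Int.castRingHom ℝ) N).symm
  refine ⟨|N.det|, fun S => ?_⟩
  have himg : T '' S = T 0 +ᵥ (T.linear '' S) := by
    have h : ∀ x, T x = T 0 +ᵥ T.linear x := fun x => by
      have := T.map_vadd 0 x
      simp only [vadd_eq_add, add_zero] at this ⊢
      rw [this, add_comm]
    ext y
    constructor
    · rintro ⟨x, hx, rfl⟩
      exact ⟨_, ⟨x, hx, rfl⟩, (h x).symm⟩
    · rintro ⟨_, ⟨x, hx, rfl⟩, rfl⟩
      exact ⟨x, hx, h x⟩
  rw [himg, measure_vadd, Measure.addHaar_image_linearMap, hdet, ENNReal.toReal_mul,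
    ENNReal.toReal_ofReal (abs_nonneg _)]
  simp

theorem volume_prod_reindex {i j d : ℕ} (e : Fin i ⊕ Fin j ≃ Fin d)
    (A : Set (Fin i → ℝ)) (B : Set (Fin j → ℝ)) :
    volume {x : Fin d → ℝ | (fun k => x (e (Sum.inl k))) ∈ A ∧ (fun k => x (e (Sum.inr k))) ∈ B}
      = volume A * volume B := by
  have h1 := volume_measurePreserving_sumPiEquivProdPi (fun _ : Fin i ⊕ Fin j => ℝ)
  have h2 := (volume_measurePreserving_piCongrLeft (fun _ : Fin d => ℝ) e).symm
  have h3 := h1.comp h2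
  rw [← Measure.prod_prod (μ := (volume : Measure (Fin i → ℝ)))
    (ν := (volume : Measure (Fin j → ℝ))) A B, ← Measure.volume_eq_prod]
  have h4 := (h1.measure_preimage_equiv (A ×ˢ B))
  have h5 := h2.measure_preimage_equiv ((MeasurableEquiv.sumPiEquivProdPi
    (fun _ : Fin i ⊕ Fin j => ℝ)) ⁻¹' (A ×ˢ B))
  rw [← h4, ← h5]
  rfl

theorem volume_chart_add {n i j d : ℕ} (e : Fin i ⊕ Fin j ≃ Fin d) (P Q : Set (Fin n → ℝ))
    (hPne : P.Nonempty) (hQne : Q.Nonempty)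
    (φ : (Fin n → ℝ) →ᵃ[ℝ] (Fin i → ℝ)) (hφ : IsLatticeChart P φ)
    (ψ : (Fin n → ℝ) →ᵃ[ℝ] (Fin j → ℝ)) (hψ : IsLatticeChart Q ψ)
    (χ : (Fin n → ℝ) →ᵃ[ℝ] (Fin d → ℝ)) (hχ : IsLatticeChart (P + Q) χ) :
    ∃ z : ℤ, (volume ((fun x => χ x) '' (P + Q))).toReal =
      (z : ℝ) * ((volume ((fun x => φ x) '' P)).toReal *
        (volume ((fun x => ψ x) '' Q)).toReal) := by
  obtain ⟨g, hgA, hg, hgi⟩ := chart_inverse P hPne φ hφ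
  obtain ⟨k, hkA, hk, hki⟩ := chart_inverse Q hQne ψ hψ
  let L : (Fin d → ℝ) →ₗ[ℝ] (Fin i → ℝ) := LinearMap.funLeft ℝ ℝ (fun a => e (Sum.inl a))
  let R : (Fin d → ℝ) →ₗ[ℝ] (Fin j → ℝ) := LinearMap.funLeft ℝ ℝ (fun a => e (Sum.inr a))
  let T : (Fin d → ℝ) →ᵃ[ℝ] (Fin d → ℝ) :=
    χ.comp (g.comp L.toAffineMap + k.comp R.toAffineMap)
  have hTx : ∀ x, T x = χ (g (L x) + k (R x)) := fun x => rfl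
  have hTi : ∀ x, IsIntPt x → IsIntPt (T x) := by
    intro x hx
    rw [hTx, ← hχ.2 _ (add_mem_affineSpan_add (hgA _) (hkA _))]
    exact isIntPt_add (hgi _ fun a => hx _) (hki _ fun a => hx _)
  obtain ⟨z, hz⟩ := volume_image_intAffine T hTi
  refine ⟨z, ?_⟩
  rw [← ENNReal.toReal_mul, ← volume_prod_reindex e, ← hz]
  congr 2
  ext y
  constructor
  · rintro ⟨_, ⟨p, hp, q, hq, rfl⟩, rfl⟩
    have hL : L (fun a => Sum.elim (φ p) (ψ q) (e.symm a)) = φ p := by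
      ext a; simp [L, LinearMap.funLeft_apply]
    have hR : R (fun a => Sum.elim (φ p) (ψ q) (e.symm a)) = ψ q := by
      ext a; simp [R, LinearMap.funLeft_apply]
    refine ⟨fun a => Sum.elim (φ p) (ψ q) (e.symm a), ⟨⟨p, hp, hL.symm⟩, ⟨q, hq, hR.symm⟩⟩, ?_⟩
    rw [hTx, hL, hR, hg p (subset_affineSpan ℝ _ hp), hk q (subset_affineSpan ℝ _ hq)]
  · rintro ⟨x, ⟨⟨p, hp, hpx⟩, ⟨q, hq, hqx⟩⟩, rfl⟩
    have hL : L x = φ p := hpx.symm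
    have hR : R x = ψ q := hqx.symm
    refine ⟨p + q, Set.add_mem_add hp hq, ?_⟩
    rw [hTx, hL, hR, hg p (subset_affineSpan ℝ _ hp), hk q (subset_affineSpan ℝ _ hq)]

theorem IsLatticePolytope.nonempty' {n : ℕ} {P : Set (Fin n → ℝ)} (hP : IsLatticePolytope P) :
    P.Nonempty := by
  obtain ⟨V, hV, rfl⟩ := hP
  rw [convexHull_nonempty_iff]
  exact (Finset.coe_nonempty.2 hV).image _

/-- If `P, Q` are lattice polytopes with `dim (P+Q) = dim P + dim Q`, then
`binom(i+j, i) · Vol(P) · Vol(Q)` divides `Vol(P+Q)`, where `i = dim P`, `j = dim Q`. -/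
theorem normVol_minkowski_sum_divisibility {n : ℕ} (P Q : Set (Fin n → ℝ))
    (hP : IsLatticePolytope P) (hQ : IsLatticePolytope Q)
    (hdim : polyDim (P + Q) = polyDim P + polyDim Q) :
    ∃ z : ℤ, normVol (P + Q) =
      (z : ℝ) * ((Nat.choose (polyDim P + polyDim Q) (polyDim P) : ℝ) *
        normVol P * normVol Q) := by
  classical
  by_cases hc : ∃ φ : (Fin n → ℝ) →ᵃ[ℝ] (Fin (polyDim (P + Q)) → ℝ), IsLatticeChart (P + Q) φ
  · have hcP := exists_latticeChart P hP
    have hcQ := exists_latticeChart Q hQ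
    obtain ⟨z, hz⟩ := volume_chart_add (finSumFinEquiv.trans (finCongr hdim.symm)) P Q
      hP.nonempty' hQ.nonempty' hcP.choose hcP.choose_spec hcQ.choose hcQ.choose_spec
      hc.choose hc.choose_spec
    refine ⟨z, ?_⟩
    simp only [normVol, dif_pos hc, dif_pos hcP, dif_pos hcQ]
    rw [hz, hdim, ← Nat.add_choose_mul_factorial_mul_factorial (polyDim P) (polyDim Q)]
    push_cast
    rw [Nat.choose_symm_add]
    ring
  · exact ⟨0, by simp only [normVol, dif_neg hc]; simp⟩

end
end

section
/- A positively homogeneous continuous piecewise linear function f : R^n → R can be represented by an integral ReLU neural network with k hidden layers if and only if f = g − h for two convex, positively homogeneous continuous piecewise linear functions g and h whose Newton polytopes P_g and P_h belong to the class P_k. -/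
open Pointwise MeasureTheory

noncomputable section

/-- `f` is positively homogeneous: `f (λ • x) = λ * f x` for all `λ ≥ 0`. -/
def PosHomR {n : ℕ} (f : (Fin n → ℝ) → ℝ) : Prop :=
  ∀ l : ℝ, 0 ≤ l → ∀ x, f (l • x) = l * f x

/-- `f` is continuous piecewise linear: `f` is continuous and there is a finite family of
affine functions such that at every point `f` agrees with one of them. -/
def IsCPWL {n : ℕ} (f : (Fin n → ℝ) → ℝ) : Prop :=
  Continuous f ∧ ∃ S : Finset ((Fin n → ℝ) × ℝ), ∀ x, ∃ p ∈ S, f x = dotR p.1 x + p.2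

/-- Compositional description of networks, biases in `S`. -/
def NN (S : Set ℤ) {n : ℕ} : ℕ → ((Fin n → ℝ) → ℝ) → Prop
  | 0, f => ∃ (a : Fin n → ℤ) (b : ℤ), b ∈ S ∧ ∀ x, f x = (∑ j, (a j : ℝ) * x j) + (b : ℝ)
  | k+1, f => ∃ (ι : Type) (_ : Fintype ι) (c : ι → ℤ) (b : ℤ) (g : ι → (Fin n → ℝ) → ℝ),
      b ∈ S ∧ (∀ i, NN S k (g i)) ∧ ∀ x, f x = (∑ i, (c i : ℝ) * max 0 (g i x)) + (b : ℝ)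

theorem NN_comp {n p : ℕ} (A : Matrix (Fin p) (Fin n) ℤ) (b : Fin p → ℤ) :
    ∀ (k : ℕ) (g : (Fin p → ℝ) → ℝ), NN Set.univ k g →
      NN Set.univ (k+1) (fun x : Fin n → ℝ =>
        g (fun i => max 0 ((∑ j, (A i j : ℝ) * x j) + (b i : ℝ))))
  | 0, g, ⟨a, b', _, h⟩ =>
      ⟨Fin p, inferInstance, a, b', fun i x => (∑ j, (A i j : ℝ) * x j) + (b i : ℝ),
        trivial, fun i => ⟨A i, b i, trivial, fun x => rfl⟩, fun x => h _⟩
  | k+1, g, ⟨ι, hι, c, b', G, _, hG, h⟩ =>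
      ⟨ι, hι, c, b', fun i x => G i (fun i => max 0 ((∑ j, (A i j : ℝ) * x j) + (b i : ℝ))),
        trivial, fun i => NN_comp A b k (G i) (hG i), fun x => h _⟩

theorem rep_NN {m : ℕ} : ∀ (k n : ℕ) (f : (Fin n → ℝ) → (Fin m → ℝ)), IntReLUrep k n m f →
    ∀ i, NN Set.univ k (fun x => f x i)
  | 0, n, f, ⟨A, b, h⟩, i => ⟨A i, b i, trivial, fun x => congrFun (h x) i⟩
  | k+1, n, f, ⟨p, A, b, g, hg, h⟩, i => by
      have := NN_comp A b k _ (rep_NN k p g hg i)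
      simpa only [h] using this

theorem rep_layer {p m : ℕ} (C : Matrix (Fin m) (Fin p) ℤ) (c : Fin m → ℤ) :
    ∀ (k n : ℕ) (G : (Fin n → ℝ) → (Fin p → ℝ)), IntReLUrep k n p G →
      IntReLUrep (k+1) n m (fun x i => (∑ j, (C i j : ℝ) * max 0 (G x j)) + (c i : ℝ))
  | 0, n, G, ⟨A, b, h⟩ => ⟨p, A, b, fun y i => (∑ j, (C i j : ℝ) * y j) + (c i : ℝ),
      ⟨C, c, fun x => rfl⟩, fun x => by simp only [h]⟩
  | k+1, n, G, ⟨q, A, b, g, hg, h⟩ =>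
      ⟨q, A, b, _, rep_layer C c k q g hg, fun x => by simp only [h]⟩

theorem NN_rep {n : ℕ} : ∀ (k m : ℕ) (f : Fin m → (Fin n → ℝ) → ℝ),
    (∀ i, NN Set.univ k (f i)) → IntReLUrep k n m (fun x i => f i x)
  | 0, m, f, h => by
      choose A b _ h using h
      exact ⟨A, b, fun x => by ext i; exact h i x⟩
  | k+1, m, f, h => by
      classical
      choose ι hι c b g _ hg h using h
      let e := Fintype.equivFin (Σ i, ι i)
      have := rep_layer (p := Fintype.card (Σ i, ι i)) (m := m)
        (fun i j => if (e.symm j).1 = i then c (e.symm j).1 (e.symm j).2 else 0) b k n _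
        (NN_rep k _ (fun j => g (e.symm j).1 (e.symm j).2) (fun j => hg _ _))
      convert this using 3 with x i
      rw [h]
      congr 1
      rw [← e.sum_comp]
      have e2 : ∀ s : (Σ i, ι i), e.symm (e s) = s := fun s => e.symm_apply_apply s
      rw [Fintype.sum_sigma, Finset.sum_eq_single i]
      · refine Finset.sum_congr rfl fun j _ => ?_
        rw [e2, if_pos rfl]
      · intro j _ hj
        refine Finset.sum_eq_zero fun l _ => ?_
        rw [e2, if_neg hj]
        simp
      · simp

theorem intReLU_iff_NN {n k : ℕ} (f : (Fin n → ℝ) → ℝ) : IntReLU n k f ↔ NN Set.univ k f := by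
  constructor
  · rintro ⟨F, hF, h⟩
    have := rep_NN k n F hF 0
    rwa [show f = fun x => F x 0 from funext h]
  · intro h
    exact ⟨_, NN_rep k 1 (fun _ => f) (fun _ => h), fun x => rfl⟩

theorem NN_smul {n k : ℕ} (z : ℤ) {f : (Fin n → ℝ) → ℝ} (hf : NN Set.univ k f) :
    NN Set.univ k (fun x => (z : ℝ) * f x) := by
  cases k with
  | zero =>
    obtain ⟨a, b, _, h⟩ := hf
    refine ⟨fun j => z * a j, z * b, trivial, fun x => ?_⟩
    simp only [h, mul_add, Finset.mul_sum]; push_cast; simp only [mul_assoc]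
  | succ k =>
    obtain ⟨ι, hι, c, b, g, _, hg, h⟩ := hf
    refine ⟨ι, hι, fun j => z * c j, z * b, g, trivial, hg, fun x => ?_⟩
    simp only [h, mul_add, Finset.mul_sum]; push_cast; simp only [mul_assoc]

theorem NN_add {n k : ℕ} {f g : (Fin n → ℝ) → ℝ} (hf : NN Set.univ k f) (hg : NN Set.univ k g) :
    NN Set.univ k (fun x => f x + g x) := by
  cases k with
  | zero =>
    obtain ⟨a, b, _, h⟩ := hf
    obtain ⟨a', b', _, h'⟩ := hg
    refine ⟨fun j => a j + a' j, b + b', trivial, fun x => ?_⟩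
    simp only [h, h']; push_cast; simp only [add_mul, Finset.sum_add_distrib]; ring
  | succ k =>
    obtain ⟨ι, hι, c, b, G, _, hG, h⟩ := hf
    obtain ⟨ι', hι', c', b', G', _, hG', h'⟩ := hg
    refine ⟨ι ⊕ ι', inferInstance, Sum.elim c c', b + b', Sum.elim G G', trivial, ?_, fun x => ?_⟩
    · rintro (i | i)
      · exact hG i
      · exact hG' i
    · simp only [h, h', Fintype.sum_sum_type, Sum.elim_inl, Sum.elim_inr]; push_cast; ring

theorem NN_zero {n : ℕ} : ∀ k, NN Set.univ k (fun _ : Fin n → ℝ => 0)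
  | 0 => ⟨0, 0, trivial, by simp⟩
  | _+1 => ⟨Empty, inferInstance, Empty.elim, 0, fun i => i.elim, trivial, fun i => i.elim,
      by simp⟩

theorem NN_relu {n k : ℕ} {f : (Fin n → ℝ) → ℝ} (hf : NN Set.univ k f) :
    NN Set.univ (k+1) (fun x => max 0 (f x)) :=
  ⟨Unit, inferInstance, fun _ => 1, 0, fun _ => f, trivial, fun _ => hf, by simp⟩

theorem NN_sub {n k : ℕ} {f g : (Fin n → ℝ) → ℝ} (hf : NN Set.univ k f) (hg : NN Set.univ k g) :
    NN Set.univ k (fun x => f x - g x) := by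
  have := NN_add hf (NN_smul (-1) hg)
  convert this using 2
  push_cast; ring

theorem NN_max {n k : ℕ} {f g : (Fin n → ℝ) → ℝ} (hf : NN Set.univ k f) (hg : NN Set.univ k g) :
    NN Set.univ (k+1) (fun x => max (f x) (g x)) := by
  have := NN_add (NN_relu (NN_sub hf hg)) (NN_sub (NN_relu hg) (NN_relu (NN_smul (-1) hg)))
  convert this using 2
  rename_i x
  push_cast
  rcases max_cases (f x) (g x) with h | h <;> rcases max_cases 0 (f x - g x) with h' | h' <;>
  rcases max_cases 0 (g x) with h'' | h'' <;> rcases max_cases 0 (-1 * g x) with h''' | h''' <;>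
  linarith

theorem NN_sum {n k : ℕ} {ι : Type} (s : Finset ι) (f : ι → (Fin n → ℝ) → ℝ)
    (hf : ∀ i, NN Set.univ k (f i)) : NN Set.univ k (fun x => ∑ i ∈ s, f i x) := by
  classical
  induction s using Finset.induction_on with
  | empty => simpa using NN_zero k
  | insert a s ha ih => simpa only [Finset.sum_insert ha] using NN_add (hf a) ih

theorem NN0_hom {n : ℕ} : ∀ (k : ℕ) (f : (Fin n → ℝ) → ℝ), NN {0} k f → PosHomR f
  | 0, f, ⟨a, b, hb, h⟩, l, hl, x => by
      obtain rfl : b = 0 := hb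
      simp only [h, Finset.mul_sum, mul_add, Pi.smul_apply, smul_eq_mul]
      simp [mul_left_comm]
  | k+1, f, ⟨ι, hι, c, b, g, hb, hg, h⟩, l, hl, x => by
      obtain rfl : b = 0 := hb
      have hm : ∀ i, max 0 (g i (l • x)) = l * max 0 (g i x) := fun i => by
        rw [NN0_hom k _ (hg i) l hl x, mul_max_of_nonneg _ _ hl, mul_zero]
      simp only [h, hm, Finset.mul_sum, mul_add]
      simp [mul_left_comm]

theorem NN_homog {n : ℕ} : ∀ (k : ℕ) (f : (Fin n → ℝ) → ℝ), NN Set.univ k f →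
    ∃ f₀, NN {0} k f₀ ∧ ∃ C : ℝ, ∀ x, |f x - f₀ x| ≤ C
  | 0, f, ⟨a, b, _, h⟩ => ⟨_, ⟨a, 0, rfl, fun x => rfl⟩, |(b : ℝ)|, fun x => by simp [h]⟩
  | k+1, f, ⟨ι, hι, c, b, g, _, hg, h⟩ => by
      choose g₀ hg₀ C hC using fun i => NN_homog k _ (hg i)
      refine ⟨_, ⟨ι, hι, c, 0, g₀, rfl, hg₀, fun x => rfl⟩, (∑ i, |(c i : ℝ)| * C i) + |(b : ℝ)|,
        fun x => ?_⟩
      have e : f x - ((∑ i, (c i : ℝ) * max 0 (g₀ i x)) + ((0 : ℤ) : ℝ)) =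
          (∑ i, (c i : ℝ) * (max 0 (g i x) - max 0 (g₀ i x))) + b := by
        rw [h]; simp only [mul_sub, Finset.sum_sub_distrib]; push_cast; ring
      rw [e]
      refine (abs_add_le _ _).trans (add_le_add_left ?_ _)
      refine (Finset.abs_sum_le_sum_abs _ _).trans (Finset.sum_le_sum fun i _ => ?_)
      rw [abs_mul]
      refine mul_le_mul_of_nonneg_left (le_trans ?_ (hC i x)) (abs_nonneg _)
      have := abs_max_sub_max_le_max 0 (g i x) 0 (g₀ i x)
      simpa using this

theorem NN0_of_hom {n k : ℕ} {f : (Fin n → ℝ) → ℝ} (hf : NN Set.univ k f) (hh : PosHomR f) :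
    NN {0} k f := by
  obtain ⟨f₀, h₀, C, hC⟩ := NN_homog k f hf
  have hh₀ := NN0_hom k f₀ h₀
  suffices f = f₀ by rwa [this]
  funext x
  by_contra hne
  have hpos : 0 < |f x - f₀ x| := abs_pos.2 (sub_ne_zero.2 hne)
  obtain ⟨N, hN⟩ := exists_nat_gt (C / |f x - f₀ x|)
  have h1 := hC ((N : ℝ) • x)
  rw [hh _ (Nat.cast_nonneg N), hh₀ _ (Nat.cast_nonneg N), ← mul_sub, abs_mul,
    abs_of_nonneg (Nat.cast_nonneg N : (0 : ℝ) ≤ N)] at h1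
  rw [div_lt_iff₀ hpos] at hN
  linarith

/-- `g` is the support function of the polytope `P`. -/
def IsSupp {n : ℕ} (P : Set (Fin n → ℝ)) (g : (Fin n → ℝ) → ℝ) : Prop :=
  ∃ (A : Finset (Fin n → ℝ)) (hA : A.Nonempty), P = convexHull ℝ (A : Set (Fin n → ℝ)) ∧
    ∀ x, g x = A.sup' hA (fun a => dotR a x)

theorem dotR_add {n : ℕ} (a b x : Fin n → ℝ) : dotR (a + b) x = dotR a x + dotR b x := by
  simp [dotR, add_mul, Finset.sum_add_distrib]

theorem dotR_smul {n : ℕ} (r : ℝ) (b x : Fin n → ℝ) : dotR (r • b) x = r * dotR b x := by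
  simp [dotR, mul_assoc, Finset.mul_sum]

theorem IsSupp.isLUB {n : ℕ} {P : Set (Fin n → ℝ)} {g : (Fin n → ℝ) → ℝ} (h : IsSupp P g)
    (x : Fin n → ℝ) : IsLUB ((fun a => dotR a x) '' P) (g x) := by
  obtain ⟨A, hA, rfl, hg⟩ := h
  constructor
  · rintro _ ⟨a, ha, rfl⟩
    have hc : Convex ℝ {a : Fin n → ℝ | dotR a x ≤ g x} :=
      convex_halfSpace_le (f := fun a => dotR a x)
        ⟨fun a b => dotR_add a b x, fun r a => dotR_smul r a x⟩ _
    refine convexHull_min ?_ hc ha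
    intro b hb
    simp only [Set.mem_ofPred_eq, hg]
    exact Finset.le_sup' (fun a => dotR a x) hb
  · intro u hu
    rw [hg]
    exact Finset.sup'_le _ _ fun a ha => hu ⟨a, subset_convexHull ℝ _ ha, rfl⟩

theorem IsSupp.unique {n : ℕ} {P : Set (Fin n → ℝ)} {g g' : (Fin n → ℝ) → ℝ} (h : IsSupp P g)
    (h' : IsSupp P g') : g = g' :=
  funext fun x => (h.isLUB x).unique (h'.isLUB x)

theorem IsSupp.singleton {n : ℕ} (a : Fin n → ℝ) : IsSupp {a} (fun x => dotR a x) :=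
  ⟨{a}, Finset.singleton_nonempty a, by simp, by simp⟩

theorem IsSupp.union {n : ℕ} {P Q : Set (Fin n → ℝ)} {g h : (Fin n → ℝ) → ℝ} (hg : IsSupp P g)
    (hh : IsSupp Q h) : IsSupp (convexHull ℝ (P ∪ Q)) (fun x => max (g x) (h x)) := by
  classical
  obtain ⟨A, hA, rfl, hg⟩ := hg
  obtain ⟨B, hB, rfl, hh⟩ := hh
  refine ⟨A ∪ B, hA.mono Finset.subset_union_left, ?_, fun x => ?_⟩
  · rw [convexHull_convexHull_union_left, convexHull_convexHull_union_right, Finset.coe_union]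
  · simp only [Finset.sup'_union hA hB, hg, hh]

theorem IsSupp.add {n : ℕ} {P Q : Set (Fin n → ℝ)} {g h : (Fin n → ℝ) → ℝ} (hg : IsSupp P g)
    (hh : IsSupp Q h) : IsSupp (P + Q) (fun x => g x + h x) := by
  classical
  obtain ⟨A, hA, rfl, hg⟩ := hg
  obtain ⟨B, hB, rfl, hh⟩ := hh
  refine ⟨A + B, hA.add hB, ?_, fun x => ?_⟩
  · rw [Finset.coe_add, convexHull_add]
  · simp only [hg, hh]
    apply le_antisymm
    · obtain ⟨a, ha, ea⟩ := Finset.exists_mem_eq_sup' hA (fun a => dotR a x)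
      obtain ⟨b, hb, eb⟩ := Finset.exists_mem_eq_sup' hB (fun a => dotR a x)
      rw [ea, eb, ← dotR_add]
      exact Finset.le_sup' (fun a => dotR a x) (Finset.add_mem_add ha hb)
    · refine Finset.sup'_le _ _ fun c hc => ?_
      obtain ⟨a, ha, b, hb, rfl⟩ := Finset.mem_add.1 hc
      rw [dotR_add]
      exact add_le_add (Finset.le_sup' (fun a => dotR a x) ha)
        (Finset.le_sup' (fun a => dotR a x) hb)

theorem IsSupp.sum {n : ℕ} {ι : Type} (s : Finset ι) {P : ι → Set (Fin n → ℝ)}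
    {g : ι → (Fin n → ℝ) → ℝ} (h : ∀ i, IsSupp (P i) (g i)) :
    IsSupp (∑ i ∈ s, P i) (fun x => ∑ i ∈ s, g i x) := by
  classical
  induction s using Finset.induction_on with
  | empty =>
    have := IsSupp.singleton (0 : Fin n → ℝ)
    simpa [dotR, ← Set.singleton_zero] using this
  | insert a s ha ih => simpa only [Finset.sum_insert ha] using (h a).add ih

theorem Pclass_NN {n : ℕ} : ∀ (k : ℕ) (P : Set (Fin n → ℝ)), InPclass k P →
    ∃ g, IsSupp P g ∧ NN Set.univ k g
  | 0, P, ⟨v, h⟩ => ⟨_, h ▸ IsSupp.singleton _, v, 0, trivial, fun x => by simp [dotR]⟩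
  | k+1, P, ⟨l, Q, _, hQ, h⟩ => by
      have : ∀ i, ∃ g, IsSupp (Q i) g ∧ NN Set.univ (k+1) g := fun i => by
        obtain ⟨Q₁, Q₂, h₁, h₂, e⟩ := hQ i
        obtain ⟨g₁, s₁, n₁⟩ := Pclass_NN k Q₁ h₁
        obtain ⟨g₂, s₂, n₂⟩ := Pclass_NN k Q₂ h₂
        exact ⟨_, e ▸ s₁.union s₂, NN_max n₁ n₂⟩
      choose g hg hn using this
      exact ⟨_, h ▸ IsSupp.sum Finset.univ hg, NN_sum Finset.univ g hn⟩

/-- Support functions of polytopes in `P_k`. -/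
def GP {n : ℕ} (k : ℕ) (g : (Fin n → ℝ) → ℝ) : Prop := ∃ P, InPclass k P ∧ IsSupp P g

theorem GP_max {n k : ℕ} {f g : (Fin n → ℝ) → ℝ} (hf : GP k f) (hg : GP k g) :
    GP (k+1) (fun x => max (f x) (g x)) := by
  obtain ⟨P, hP, sP⟩ := hf
  obtain ⟨Q, hQ, sQ⟩ := hg
  exact ⟨_, ⟨1, fun _ => convexHull ℝ (P ∪ Q), one_pos, fun _ => ⟨P, Q, hP, hQ, rfl⟩, by simp⟩,
    sP.union sQ⟩

theorem GP_succ {n k : ℕ} {f : (Fin n → ℝ) → ℝ} (hf : GP k f) : GP (k+1) f := by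
  simpa using GP_max hf hf

theorem GP_zero {n : ℕ} : ∀ k, GP k (fun _ : Fin n → ℝ => 0)
  | 0 => ⟨{0}, ⟨0, by simp; rfl⟩,
      by simpa [dotR] using IsSupp.singleton (0 : Fin n → ℝ)⟩
  | k+1 => GP_succ (GP_zero k)

theorem GP_add {n k : ℕ} {f g : (Fin n → ℝ) → ℝ} (hf : GP (k+1) f) (hg : GP (k+1) g) :
    GP (k+1) (fun x => f x + g x) := by
  obtain ⟨P, ⟨l, Q, hl, hQ, rfl⟩, sP⟩ := hf
  obtain ⟨P', ⟨l', Q', hl', hQ', rfl⟩, sP'⟩ := hg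
  refine ⟨_, ⟨l + l', Fin.append Q Q', by omega, fun i => ?_, ?_⟩, sP.add sP'⟩
  · refine Fin.addCases (fun i => ?_) (fun i => ?_) i
    · simpa using hQ i
    · simpa using hQ' i
  · simp [Fin.sum_univ_add]

/-- Differences. -/
def DP {n : ℕ} (k : ℕ) (f : (Fin n → ℝ) → ℝ) : Prop :=
  ∃ g h, GP k g ∧ GP k h ∧ f = fun x => g x - h x

theorem DP_add {n k : ℕ} {f g : (Fin n → ℝ) → ℝ} (hf : DP (k+1) f) (hg : DP (k+1) g) :
    DP (k+1) (fun x => f x + g x) := by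
  obtain ⟨a, b, ha, hb, rfl⟩ := hf
  obtain ⟨c, d, hc, hd, rfl⟩ := hg
  exact ⟨_, _, GP_add ha hc, GP_add hb hd, by funext x; ring⟩

theorem DP_neg {n k : ℕ} {f : (Fin n → ℝ) → ℝ} (hf : DP k f) : DP k (fun x => - f x) := by
  obtain ⟨a, b, ha, hb, rfl⟩ := hf
  exact ⟨_, _, hb, ha, by funext x; ring⟩

theorem DP_zero {n : ℕ} (k : ℕ) : DP k (fun _ : Fin n → ℝ => 0) :=
  ⟨_, _, GP_zero k, GP_zero k, by simp⟩

theorem DP_smul {n k : ℕ} {f : (Fin n → ℝ) → ℝ} (hf : DP (k+1) f) (z : ℤ) :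
    DP (k+1) (fun x => (z : ℝ) * f x) := by
  have key : ∀ N : ℕ, DP (k+1) (fun x => (N : ℝ) * f x) := fun N => by
    induction N with
    | zero => simpa using DP_zero (k+1)
    | succ N ih =>
      have := DP_add ih hf
      convert this using 2
      push_cast; ring
  obtain ⟨N, rfl | rfl⟩ := z.eq_nat_or_neg
  · simpa using key N
  · simpa using DP_neg (key N)

theorem DP_sum {n k : ℕ} {ι : Type} (s : Finset ι) (f : ι → (Fin n → ℝ) → ℝ)
    (hf : ∀ i, DP (k+1) (f i)) : DP (k+1) (fun x => ∑ i ∈ s, f i x) := by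
  classical
  induction s using Finset.induction_on with
  | empty => simpa using DP_zero (k+1)
  | insert a s ha ih => simpa only [Finset.sum_insert ha] using DP_add (hf a) ih

theorem NN0_DP {n : ℕ} : ∀ (k : ℕ) (f : (Fin n → ℝ) → ℝ), NN {0} k f → DP k f
  | 0, f, ⟨a, b, hb, h⟩ => by
      obtain rfl : b = 0 := hb
      exact ⟨_, _, ⟨_, ⟨a, rfl⟩, IsSupp.singleton _⟩, GP_zero 0, by funext x; simp [h, dotR]⟩
  | k+1, f, ⟨ι, hι, c, b, g, hb, hg, h⟩ => by
      obtain rfl : b = 0 := hb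
      have e : f = fun x => ∑ i, (c i : ℝ) * max 0 (g i x) := by funext x; simp [h]
      rw [e]
      refine DP_sum Finset.univ _ fun i => DP_smul ?_ (c i)
      obtain ⟨p, q, hp, hq, e⟩ := NN0_DP k _ (hg i)
      refine ⟨_, _, GP_max hp hq, GP_succ hq, ?_⟩
      funext x
      rw [e, ← max_sub_sub_right, sub_self, max_comm]

/-- A positively homogeneous CPWL function `f` is computable by an integral ReLU network
with `k` hidden layers iff `f = g - h` for convex positively homogeneous CPWL functions
`g = max_{a ∈ A} aᵀx` and `h = max_{b ∈ B} bᵀx` whose Newton polytopes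
`P_g = conv A` and `P_h = conv B` lie in the class `P_k`. -/
theorem intReLU_iff_newton_polytopes_in_Pk {n : ℕ} (k : ℕ) (f : (Fin n → ℝ) → ℝ)
    (hhom : PosHomR f) (hcpwl : IsCPWL f) :
    IntReLU n k f ↔
      ∃ (A B : Finset (Fin n → ℝ)) (hA : A.Nonempty) (hB : B.Nonempty),
        (∀ x, f x = A.sup' hA (fun a => dotR a x) - B.sup' hB (fun b => dotR b x)) ∧
        InPclass k (convexHull ℝ (A : Set (Fin n → ℝ))) ∧
        InPclass k (convexHull ℝ (B : Set (Fin n → ℝ))) := by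
  rw [intReLU_iff_NN]
  constructor
  · intro h
    obtain ⟨_, _, ⟨P, hP, A, hA, rfl, eA⟩, ⟨Q, hQ, B, hB, rfl, eB⟩, e⟩ :=
      NN0_DP k f (NN0_of_hom h hhom)
    exact ⟨A, B, hA, hB, fun x => by simp only [e, eA, eB], hP, hQ⟩
  · rintro ⟨A, B, hA, hB, e, hP, hQ⟩
    obtain ⟨g, sg, ng⟩ := Pclass_NN k _ hP
    obtain ⟨h, sh, nh⟩ := Pclass_NN k _ hQ
    have eg := sg.unique ⟨A, hA, rfl, fun x => rfl⟩
    have eh := sh.unique ⟨B, hB, rfl, fun x => rfl⟩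
    have := NN_sub ng nh
    rw [eg, eh] at this
    rwa [show f = _ from funext e]

end
end

section
/- For any two polytopes P and Q in R^n, there exists a polyhedral subdivision of the Minkowski sum P + Q such that every full-dimensional cell C of the subdivision is of the form C = F + G for a face F of P and a face G of Q with dim(F + G) = dim(F) + dim(G) (i.e., C is an affine product of a face of P and a face of Q). -/
open Pointwise MeasureTheory

noncomputable section

theorem aux_farkas {E ι : Type*} [AddCommGroup E] [Module ℝ E] [DecidableEq ι] (s : Finset ι) :
    ∀ (a : ι → E →ₗ[ℝ] ℝ) (b : E →ₗ[ℝ] ℝ),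
    (∀ x, (∀ i ∈ s, 0 ≤ a i x) → 0 ≤ b x) →
    ∃ l : ι → ℝ, (∀ i, 0 ≤ l i) ∧ b = ∑ i ∈ s, l i • a i := by
  induction s using Finset.induction_on with
  | empty =>
    intro a b h
    refine ⟨0, fun _ => le_rfl, ?_⟩
    ext x
    have h1 := h x (by simp)
    have h2 := h (-x) (by simp)
    simp at h2 ⊢
    linarith
  | insert j s hj ih =>
    intro a b h
    by_cases hc : ∀ x, (∀ i ∈ s, 0 ≤ a i x) → 0 ≤ b x
    · obtain ⟨l, hl, hb⟩ := ih a b hc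
      refine ⟨fun i => if i = j then 0 else l i, ?_, ?_⟩
      · intro i
        dsimp only
        split_ifs
        · exact le_rfl
        · exact hl i
      · rw [Finset.sum_insert hj, hb]
        simp only [if_true, zero_smul, zero_add]
        refine Finset.sum_congr rfl fun i hi => ?_
        have hij : i ≠ j := by rintro rfl; exact hj hi
        simp [hij]
    · push Not at hc
      obtain ⟨x0, hx0, hb0⟩ := hc
      have hj0 : a j x0 < 0 := by
        by_contra hh
        push Not at hh
        have := h x0 (by
          intro i hi
          rcases Finset.mem_insert.1 hi with rfl | hi
          · exact hh
          · exact hx0 i hi)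
        linarith
      set y := (-(a j x0))⁻¹ • x0 with hy
      have hpos : 0 < (-(a j x0))⁻¹ := by
        apply inv_pos.2; linarith
      have hjy : a j y = -1 := by
        rw [hy, map_smul, smul_eq_mul]
        have : a j x0 ≠ 0 := hj0.ne
        field_simp
      have hby : b y < 0 := by
        rw [hy, map_smul, smul_eq_mul]
        exact mul_neg_of_pos_of_neg hpos hb0
      have hiy : ∀ i ∈ s, 0 ≤ a i y := by
        intro i hi
        rw [hy, map_smul, smul_eq_mul]
        exact mul_nonneg hpos.le (hx0 i hi)
      obtain ⟨l, hl, hb⟩ := ih (fun i => a i + (a i y) • a j) (b + (b y) • a j) (by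
        intro x hx
        have := h (x + (a j x) • y) (by
          intro i hi
          rcases Finset.mem_insert.1 hi with rfl | hi
          · simp [hjy]
          · have := hx i hi
            simp at this ⊢
            linarith)
        simp at this ⊢
        linarith)
      refine ⟨fun i => if i = j then (∑ i ∈ s, l i * a i y) - b y else l i, ?_, ?_⟩
      · intro i
        dsimp only
        split_ifs
        · have : 0 ≤ ∑ i ∈ s, l i * a i y :=
            Finset.sum_nonneg fun i hi => mul_nonneg (hl i) (hiy i hi)
          linarith
        · exact hl i
      · rw [Finset.sum_insert hj]
        have e : ∑ i ∈ s, (if i = j then (∑ i ∈ s, l i * a i y) - b y else l i) • a i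
            = ∑ i ∈ s, l i • a i := by
          refine Finset.sum_congr rfl fun i hi => ?_
          have hij : i ≠ j := by rintro rfl; exact hj hi
          simp [hij]
        rw [e]
        simp only [if_true]
        ext x
        have hbx := congrArg (fun f => f x) hb
        simp [LinearMap.sum_apply, mul_add, Finset.sum_add_distrib] at hbx ⊢
        rw [sub_mul, Finset.sum_mul]
        simp only [mul_assoc]
        linarith

theorem aux_move {E : Type*} [AddCommGroup E] [Module ℝ E] (P : Set E) (hP : Convex ℝ P)
    (p : E) (hp : p ∈ P) (V : Finset E) (hV : ∀ v ∈ V, v ∈ P) (l : E → ℝ) (hl : ∀ v, 0 ≤ l v)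
    (ε : ℝ) (hε : 0 ≤ ε) (h : ε * ∑ v ∈ V, l v ≤ 1) :
    p + ε • ∑ v ∈ V, l v • (v - p) ∈ P := by
  have := hP.sum_mem (t := V.disjSum {()})
    (w := Sum.elim (fun v => ε * l v) (fun _ => 1 - ε * ∑ v ∈ V, l v))
    (z := Sum.elim (fun v => v) (fun _ => p)) (by
      rintro (v | v) _
      · exact mul_nonneg hε (hl v)
      · simpa using h) (by
      rw [Finset.sum_disjSum]
      simp [Finset.mul_sum]) (by
      rintro (v | v) hv
      · exact hV v (by simpa using hv)
      · exact hp)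
  rw [Finset.sum_disjSum] at this
  convert this using 1
  simp [smul_sub, Finset.sum_sub_distrib, sub_smul, Finset.smul_sum, Finset.mul_sum, mul_smul,
    Finset.sum_smul]
  abel

theorem dotR_eq {n : ℕ} (c x : Fin n → ℝ) : dotR c x = c ⬝ᵥ x := rfl

theorem aux_argmin {n : ℕ} (V : Finset (Fin n → ℝ)) (hV : V.Nonempty) (c : Fin n → ℝ) :
    ∃ A : Finset (Fin n → ℝ), A ⊆ V ∧ A.Nonempty ∧
      argminSet c (convexHull ℝ (V : Set (Fin n → ℝ))) = convexHull ℝ (A : Set (Fin n → ℝ)) := by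
  classical
  obtain ⟨v0, hv0, hmin⟩ := V.exists_min_image (fun v => c ⬝ᵥ v) hV
  have hlow : ∀ y ∈ convexHull ℝ (V : Set (Fin n → ℝ)), c ⬝ᵥ v0 ≤ c ⬝ᵥ y := by
    have hc : Convex ℝ {y : Fin n → ℝ | c ⬝ᵥ v0 ≤ c ⬝ᵥ y} :=
      convex_halfSpace_ge ⟨dotProduct_add c, fun r x => dotProduct_smul r c x⟩ _
    intro y hy
    exact convexHull_min (fun v hv => hmin v hv) hc hy
  refine ⟨V.filter (fun v => c ⬝ᵥ v = c ⬝ᵥ v0), Finset.filter_subset _ _,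
    ⟨v0, by simp [hv0]⟩, ?_⟩
  ext x
  constructor
  · rintro ⟨hx, hx2⟩
    have hx3 : c ⬝ᵥ x ≤ c ⬝ᵥ v0 := hx2 v0 (subset_convexHull ℝ _ hv0)
    rw [Finset.mem_convexHull'] at hx
    obtain ⟨w, hw, hw1, rfl⟩ := hx
    have hz : ∑ v ∈ V, w v * (c ⬝ᵥ v - c ⬝ᵥ v0) = 0 := by
      apply le_antisymm
      · simp only [mul_sub, Finset.sum_sub_distrib, ← Finset.sum_mul, hw1]
        simp only [dotProduct_sum, dotProduct_smul, smul_eq_mul] at hx3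
        linarith
      · exact Finset.sum_nonneg fun v hv => mul_nonneg (hw v hv) (sub_nonneg.2 (hmin v hv))
    rw [Finset.sum_eq_zero_iff_of_nonneg
      (fun v hv => mul_nonneg (hw v hv) (sub_nonneg.2 (hmin v hv)))] at hz
    have hz' : ∀ v ∈ V, ¬ (c ⬝ᵥ v = c ⬝ᵥ v0) → w v = 0 := by
      intro v hv hne
      rcases mul_eq_zero.1 (hz v hv) with h | h
      · exact h
      · exact absurd (sub_eq_zero.1 h) hne
    rw [Finset.mem_convexHull']
    refine ⟨w, fun v hv => hw v (Finset.mem_filter.1 hv).1, ?_, ?_⟩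
    · rw [← hw1]
      refine Finset.sum_subset (Finset.filter_subset _ _) ?_
      intro v hv hv2
      exact hz' v hv (fun e => hv2 (Finset.mem_filter.2 ⟨hv, e⟩))
    · refine Finset.sum_subset (Finset.filter_subset _ _) ?_
      intro v hv hv2
      rw [hz' v hv (fun e => hv2 (Finset.mem_filter.2 ⟨hv, e⟩)), zero_smul]
  · intro hx
    have hc : Convex ℝ {y : Fin n → ℝ | c ⬝ᵥ y = c ⬝ᵥ v0} :=
      convex_hyperplane ⟨dotProduct_add c, fun r x => dotProduct_smul r c x⟩ _
    have hx1 : c ⬝ᵥ x = c ⬝ᵥ v0 :=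
      convexHull_min (fun v hv => by
        exact (Finset.mem_filter.1 hv).2) hc hx
    refine ⟨convexHull_mono (by exact_mod_cast Finset.filter_subset _ _) hx, fun y hy => ?_⟩
    rw [dotR_eq, dotR_eq, hx1]
    exact hlow y hy

/-- cover: optimal pairs admit a multiplier -/
theorem aux_cover {n : ℕ} (V W : Finset (Fin n → ℝ)) (α p q : Fin n → ℝ)
    (hp : p ∈ convexHull ℝ (V : Set (Fin n → ℝ))) (hq : q ∈ convexHull ℝ (W : Set (Fin n → ℝ)))
    (hopt : ∀ p' ∈ convexHull ℝ (V : Set (Fin n → ℝ)), ∀ q' ∈ convexHull ℝ (W : Set (Fin n → ℝ)),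
      p' + q' = p + q → α ⬝ᵥ p ≤ α ⬝ᵥ p') :
    ∃ c : Fin n → ℝ, p ∈ argminSet (c + α) (convexHull ℝ (V : Set (Fin n → ℝ))) ∧
      q ∈ argminSet c (convexHull ℝ (W : Set (Fin n → ℝ))) := by
  classical
  by_contra hno
  let ev : (Fin n → ℝ) → ((Fin n → ℝ) × ℝ) →ₗ[ℝ] ℝ := fun s =>
    { toFun := fun z => z.1 ⬝ᵥ s
      map_add' := fun x y => by simp [add_dotProduct]
      map_smul' := fun r x => by simp [smul_dotProduct] }
  have hev : ∀ s z, ev s z = z.1 ⬝ᵥ s := fun _ _ => rfl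
  let sn : ((Fin n → ℝ) × ℝ) →ₗ[ℝ] ℝ := LinearMap.snd ℝ _ _
  have hsn : ∀ z, sn z = z.2 := fun _ => rfl
  obtain ⟨l, hl, hb⟩ := aux_farkas (V.disjSum W)
    (Sum.elim (fun v => ev (v - p) + (α ⬝ᵥ (v - p)) • sn) (fun w => ev (w - q))) (-sn) (by
    rintro ⟨c, t⟩ hx
    by_contra ht
    have ht : 0 < t := by simpa [hsn] using ht
    apply hno
    have hA : ∀ v ∈ V, 0 ≤ c ⬝ᵥ (v - p) + α ⬝ᵥ (v - p) * t := by
      intro v hv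
      simpa [hev, hsn] using hx (Sum.inl v) (by simpa using hv)
    have hB : ∀ w ∈ W, 0 ≤ c ⬝ᵥ (w - q) := by
      intro v hv
      simpa [hev, hsn] using hx (Sum.inr v) (by simpa using hv)
    refine ⟨t⁻¹ • c, ⟨hp, ?_⟩, ⟨hq, ?_⟩⟩
    · intro y hy
      have hc : Convex ℝ {y : Fin n → ℝ | (t⁻¹ • c + α) ⬝ᵥ p ≤ (t⁻¹ • c + α) ⬝ᵥ y} :=
        convex_halfSpace_ge ⟨dotProduct_add _, fun r x => dotProduct_smul r _ x⟩ _
      refine convexHull_min (fun v hv => ?_) hc hy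
      have h1 := mul_nonneg (inv_pos.2 ht).le (hA v hv)
      have h2 : t⁻¹ * (c ⬝ᵥ (v - p) + α ⬝ᵥ (v - p) * t)
          = t⁻¹ * (c ⬝ᵥ (v - p)) + α ⬝ᵥ (v - p) := by field_simp
      rw [h2] at h1
      simp only [Set.mem_ofPred_eq, add_dotProduct, smul_dotProduct, smul_eq_mul]
      simp only [dotProduct_sub] at h1
      linarith
    · intro y hy
      have hc : Convex ℝ {y : Fin n → ℝ | (t⁻¹ • c) ⬝ᵥ q ≤ (t⁻¹ • c) ⬝ᵥ y} :=
        convex_halfSpace_ge ⟨dotProduct_add _, fun r x => dotProduct_smul r _ x⟩ _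
      refine convexHull_min (fun v hv => ?_) hc hy
      have h1 := mul_nonneg (inv_pos.2 ht).le (hB v hv)
      simp only [Set.mem_ofPred_eq, smul_dotProduct, smul_eq_mul]
      simp only [dotProduct_sub] at h1
      linarith)
  rw [Finset.sum_disjSum] at hb
  simp only [Sum.elim_inl, Sum.elim_inr] at hb
  set a := ∑ v ∈ V, l (Sum.inl v) • (v - p) with ha
  set b := ∑ w ∈ W, l (Sum.inr w) • (w - q) with hbb
  have h1 : α ⬝ᵥ a = -1 := by
    have := congrArg (fun f => f (0, 1)) hb
    simp [hev, hsn, LinearMap.sum_apply] at this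
    rw [ha, this]
    simp [dotProduct_sum, dotProduct_smul]
  have h2 : a + b = 0 := by
    apply dotProduct_eq_zero_iff.1
    intro c
    have := congrArg (fun f => f (c, 0)) hb
    simp [hev, hsn, LinearMap.sum_apply] at this
    rw [dotProduct_comm, dotProduct_add, ha, hbb]
    simp only [dotProduct_sum, dotProduct_smul, smul_eq_mul, dotProduct_sub]
    linarith
  set L := ∑ v ∈ V, l (Sum.inl v) with hL
  set M := ∑ w ∈ W, l (Sum.inr w) with hM
  have hL0 : 0 ≤ L := Finset.sum_nonneg fun _ _ => hl _
  have hM0 : 0 ≤ M := Finset.sum_nonneg fun _ _ => hl _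
  have hε : 0 < (1 + L + M)⁻¹ := by positivity
  have hmp := aux_move _ (convex_convexHull ℝ (V : Set (Fin n → ℝ))) p hp V
    (fun v hv => subset_convexHull ℝ _ hv) (fun v => l (Sum.inl v)) (fun _ => hl _)
    (1 + L + M)⁻¹ hε.le (by
      rw [inv_mul_le_iff₀ (by positivity)]; linarith)
  have hmq := aux_move _ (convex_convexHull ℝ (W : Set (Fin n → ℝ))) q hq W
    (fun v hv => subset_convexHull ℝ _ hv) (fun v => l (Sum.inr v)) (fun _ => hl _)
    (1 + L + M)⁻¹ hε.le (by
      rw [inv_mul_le_iff₀ (by positivity)]; linarith)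
  have := hopt _ hmp _ hmq (by
    rw [← ha, ← hbb, add_add_add_comm, ← smul_add, h2, smul_zero, add_zero])
  rw [← ha, dotProduct_add, dotProduct_smul, h1, smul_eq_mul] at this
  linarith

theorem aux_inter {n : ℕ} (P Q : Set (Fin n → ℝ)) (α c d : Fin n → ℝ) :
    IsFace (argminSet (c + α) P + argminSet c Q)
      ((argminSet (c + α) P + argminSet c Q) ∩ (argminSet (d + α) P + argminSet d Q)) := by
  by_cases he : ((argminSet (c + α) P + argminSet c Q) ∩
      (argminSet (d + α) P + argminSet d Q)) = ∅
  · exact Or.inl he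
  right
  obtain ⟨x0, hx0⟩ := Set.nonempty_iff_ne_empty.2 he
  refine ⟨d - c, ?_⟩
  have key : ∀ p ∈ argminSet (c + α) P, ∀ q ∈ argminSet c Q, ∀ p' ∈ argminSet (d + α) P,
      ∀ q' ∈ argminSet d Q, dotR (d + α) p' + dotR d q' - dotR (c + α) p - dotR c q
        ≤ dotR (d - c) (p + q) := by
    intro p hp q hq p' hp' q' hq'
    have h1 := hp'.2 p hp.1
    have h2 := hq'.2 q hq.1
    simp only [dotR_eq, add_dotProduct, sub_dotProduct, dotProduct_add] at *
    linarith
  have key2 : ∀ p ∈ argminSet (c + α) P, ∀ q ∈ argminSet c Q, ∀ p' ∈ argminSet (d + α) P,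
      ∀ q' ∈ argminSet d Q, p' + q' = p + q →
      dotR (d - c) (p + q) = dotR (d + α) p' + dotR d q' - dotR (c + α) p - dotR c q := by
    intro p hp q hq p' hp' q' hq' e
    have h1 := hp'.2 p hp.1
    have h2 := hq'.2 q hq.1
    have h3 := hp.2 p' hp'.1
    have h4 := hq.2 q' hq'.1
    have e1 := congrArg (fun z => c ⬝ᵥ z) e
    have e2 := congrArg (fun z => d ⬝ᵥ z) e
    simp only [dotR_eq, add_dotProduct, sub_dotProduct, dotProduct_add] at *
    linarith
  obtain ⟨⟨p0, hp0, q0, hq0, h0⟩, ⟨p1, hp1, q1, hq1, h1⟩⟩ := hx0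
  have e0 := key2 p0 hp0 q0 hq0 p1 hp1 q1 hq1 (h1.trans h0.symm)
  ext x
  constructor
  · rintro ⟨hx, hx'⟩
    refine ⟨hx, ?_⟩
    obtain ⟨p, hp, q, hq, rfl⟩ := hx
    obtain ⟨p', hp', q', hq', e⟩ := hx'
    rintro y ⟨r, hr, s, hs, rfl⟩
    have h1 := key2 p hp q hq p' hp' q' hq' e
    have h2 := key r hr s hs p' hp' q' hq'
    have h3 := hr.2 p hp.1
    have h4 := hs.2 q hq.1
    dsimp only at *
    linarith
  · rintro ⟨hx, hx'⟩
    refine ⟨hx, ?_⟩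
    obtain ⟨p, hp, q, hq, rfl⟩ := hx
    have h1 := hx' _ ⟨p0, hp0, q0, hq0, rfl⟩
    dsimp only at h1
    rw [e0] at h1
    have h2 := hp0.2 p hp.1
    have h3 := hq0.2 q hq.1
    have h4 := hp1.2 p hp.1
    have h5 := hq1.2 q hq.1
    have h2' := hp.2 p0 hp0.1
    have h3' := hq.2 q0 hq0.1
    have hs : dotR (d + α) p ≤ dotR (d + α) p1 ∧ dotR d q ≤ dotR d q1 := by
      simp only [dotR_eq, add_dotProduct, sub_dotProduct, dotProduct_add] at *
      constructor <;> linarith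
    exact ⟨p, ⟨hp.1, fun y hy => hs.1.trans (hp1.2 y hy)⟩, q,
      ⟨hq.1, fun y hy => hs.2.trans (hq1.2 y hy)⟩, rfl⟩

theorem aux_vectorSpan_add {n : ℕ} (F G : Set (Fin n → ℝ)) (hF : F.Nonempty) (hG : G.Nonempty) :
    vectorSpan ℝ (F + G) = vectorSpan ℝ F ⊔ vectorSpan ℝ G := by
  apply le_antisymm
  · rw [vectorSpan_def, Submodule.span_le]
    rintro _ ⟨_, ⟨p, hp, q, hq, rfl⟩, _, ⟨p', hp', q', hq', rfl⟩, rfl⟩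
    have : (p + q) -ᵥ (p' + q') = (p -ᵥ p') + (q -ᵥ q') := by
      simp only [vsub_eq_sub]; abel
    dsimp only
    rw [this]
    exact Submodule.add_mem_sup (vsub_mem_vectorSpan ℝ hp hp') (vsub_mem_vectorSpan ℝ hq hq')
  · obtain ⟨f, hf⟩ := hF
    obtain ⟨g, hg⟩ := hG
    refine sup_le ?_ ?_
    · rw [vectorSpan_def, Submodule.span_le]
      rintro _ ⟨p, hp, p', hp', rfl⟩
      have := vsub_mem_vectorSpan ℝ (Set.add_mem_add hp hg) (Set.add_mem_add hp' hg)
      simpa using this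
    · rw [vectorSpan_def, Submodule.span_le]
      rintro _ ⟨p, hp, p', hp', rfl⟩
      have := vsub_mem_vectorSpan ℝ (Set.add_mem_add hf hp) (Set.add_mem_add hf hp')
      simpa using this

theorem aux_ortho {n : ℕ} (c : Fin n → ℝ) (P : Set (Fin n → ℝ)) (v : Fin n → ℝ)
    (hv : v ∈ vectorSpan ℝ (argminSet c P)) : c ⬝ᵥ v = 0 := by
  rw [vectorSpan_def] at hv
  induction hv using Submodule.span_induction with
  | mem x hx =>
    obtain ⟨p, hp, q, hq, rfl⟩ := hx
    have h1 := hp.2 q hq.1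
    have h2 := hq.2 p hp.1
    simp only [dotR_eq] at h1 h2
    simp only [vsub_eq_sub, dotProduct_sub]
    linarith
  | zero => simp
  | add x y _ _ hx hy => rw [dotProduct_add, hx, hy, add_zero]
  | smul r x _ hx => rw [dotProduct_smul, hx, smul_zero]

theorem aux_generic {n : ℕ} (V W : Finset (Fin n → ℝ)) : ∃ α : Fin n → ℝ,
    ∀ A ⊆ V, ∀ B ⊆ W,
      (∀ v ∈ vectorSpan ℝ (convexHull ℝ (A : Set (Fin n → ℝ))) ⊓
        vectorSpan ℝ (convexHull ℝ (B : Set (Fin n → ℝ))), α ⬝ᵥ v = 0) →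
      vectorSpan ℝ (convexHull ℝ (A : Set (Fin n → ℝ))) ⊓
        vectorSpan ℝ (convexHull ℝ (B : Set (Fin n → ℝ))) = ⊥ := by
  classical
  let S : Finset (Fin n → ℝ) × Finset (Fin n → ℝ) → Submodule ℝ (Fin n → ℝ) := fun x =>
    vectorSpan ℝ (convexHull ℝ (x.1 : Set (Fin n → ℝ))) ⊓
        vectorSpan ℝ (convexHull ℝ (x.2 : Set (Fin n → ℝ)))
  let T := (V.powerset ×ˢ W.powerset).filter (fun x => S x ≠ ⊥)
  have hT : ∀ i : T, ∃ v ∈ S i.1, v ≠ 0 := fun i =>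
    Submodule.exists_mem_ne_zero_of_ne_bot (Finset.mem_filter.1 i.2).2
  choose v hv hv0 using hT
  obtain ⟨f, hf⟩ := Module.exists_dual_forall_apply_ne_zero (K := ℝ) v hv0
  refine ⟨(dotProductEquiv ℝ (Fin n)).symm f, fun A hA B hB h => ?_⟩
  by_contra hne
  have hm : (A, B) ∈ T := Finset.mem_filter.2 ⟨by simp [hA, hB], hne⟩
  apply hf ⟨(A, B), hm⟩
  have h2 := h _ (hv ⟨(A, B), hm⟩)
  rw [← dotProductEquiv_apply_apply, LinearEquiv.apply_symm_apply] at h2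
  exact h2

/-- The Minkowski sum `P + Q` of two polytopes admits a subdivision in which every
full-dimensional cell is an affine product `F + G` of a face `F` of `P` and a face `G`
of `Q` (i.e. `dim (F+G) = dim F + dim G`). -/
theorem subdivision_of_minkowski_sum_into_affine_products {n : ℕ}
    (P Q : Set (Fin n → ℝ)) (hP : IsPolytope P) (hQ : IsPolytope Q) :
    ∃ 𝒞 : Finset (Set (Fin n → ℝ)), IsSubdivision (P + Q) 𝒞 ∧
      ∀ C ∈ 𝒞, polyDim C = polyDim (P + Q) →
        ∃ F G : Set (Fin n → ℝ), IsFace P F ∧ IsFace Q G ∧ C = F + G ∧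
          polyDim (F + G) = polyDim F + polyDim G := by
  classical
  obtain ⟨V, hV, rfl⟩ := hP
  obtain ⟨W, hW, rfl⟩ := hQ
  obtain ⟨α, hα⟩ := aux_generic V W
  set P := convexHull ℝ (V : Set (Fin n → ℝ)) with hPdef
  set Q := convexHull ℝ (W : Set (Fin n → ℝ)) with hQdef
  have hfin : (Set.range fun c : Fin n → ℝ => argminSet (c + α) P + argminSet c Q).Finite := by
    refine (Finset.finite_toSet ((V.powerset ×ˢ W.powerset).image (fun x =>
      convexHull ℝ (x.1 : Set (Fin n → ℝ)) + convexHull ℝ (x.2 : Set (Fin n → ℝ))))).subset ?_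
    rintro _ ⟨c, rfl⟩
    obtain ⟨A, hA, _, eA⟩ := aux_argmin V hV (c + α)
    obtain ⟨B, hB, _, eB⟩ := aux_argmin W hW c
    rw [Finset.mem_coe, Finset.mem_image]
    exact ⟨(A, B), by simp [hA, hB], by dsimp only; rw [eA, eB]⟩
  refine ⟨hfin.toFinset, ⟨?_, ?_, ?_⟩, ?_⟩
  · intro C hC
    obtain ⟨c, rfl⟩ := hfin.mem_toFinset.1 hC
    obtain ⟨A, hA, hA0, eA⟩ := aux_argmin V hV (c + α)
    obtain ⟨B, hB, hB0, eB⟩ := aux_argmin W hW c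
    refine ⟨A + B, hA0.add hB0, ?_⟩
    rw [Finset.coe_add, convexHull_add, ← eA, ← eB]
  · apply Set.Subset.antisymm
    · refine Set.iUnion₂_subset fun C hC => ?_
      obtain ⟨c, rfl⟩ := hfin.mem_toFinset.1 hC
      exact Set.add_subset_add (fun x hx => hx.1) (fun x hx => hx.1)
    · rintro x ⟨p1, hp1, q1, hq1, rfl⟩
      have hPc : IsCompact P := (Finset.finite_toSet V).isCompact_convexHull ℝ
      have hQc : IsCompact Q := (Finset.finite_toSet W).isCompact_convexHull ℝ
      have hK : IsCompact (P ∩ (fun p => p1 + q1 - p) ⁻¹' Q) :=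
        hPc.inter_right (hQc.isClosed.preimage (by fun_prop))
      obtain ⟨p, ⟨hp, hq⟩, hmin⟩ := hK.exists_isMinOn (f := fun p => α ⬝ᵥ p)
        ⟨p1, hp1, by simpa using hq1⟩
        (by
          unfold dotProduct
          fun_prop)
      obtain ⟨c, hc1, hc2⟩ := aux_cover V W α p (p1 + q1 - p) hp hq (by
        intro p' hp' q' hq' e
        refine hmin ⟨hp', ?_⟩
        have : p1 + q1 - p' = q' := by
          rw [sub_eq_iff_eq_add, add_comm q', e]; abel
        simpa [this] using hq')
      refine Set.mem_iUnion₂.2 ⟨_, hfin.mem_toFinset.2 ⟨c, rfl⟩, ?_⟩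
      exact ⟨p, hc1, _, hc2, by simp⟩
  · intro C hC D hD
    obtain ⟨c, rfl⟩ := hfin.mem_toFinset.1 hC
    obtain ⟨d, rfl⟩ := hfin.mem_toFinset.1 hD
    refine ⟨aux_inter P Q α c d, ?_⟩
    dsimp only
    rw [Set.inter_comm]
    exact aux_inter P Q α d c
  · intro C hC _
    obtain ⟨c, rfl⟩ := hfin.mem_toFinset.1 hC
    obtain ⟨A, hA, hA0, eA⟩ := aux_argmin V hV (c + α)
    obtain ⟨B, hB, hB0, eB⟩ := aux_argmin W hW c
    refine ⟨argminSet (c + α) P, argminSet c Q, Or.inr ⟨_, rfl⟩, Or.inr ⟨_, rfl⟩, rfl, ?_⟩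
    have hbot := hα A hA B hB (by
      rw [← eA, ← eB]
      rintro v ⟨h1, h2⟩
      have h1 := aux_ortho _ _ _ h1
      have h2 := aux_ortho _ _ _ h2
      rw [add_dotProduct] at h1
      linarith)
    rw [← eA, ← eB] at hbot
    have hFn : (argminSet (c + α) P).Nonempty := by
      rw [eA]; exact (Finset.coe_nonempty.2 hA0).convexHull
    have hGn : (argminSet c Q).Nonempty := by
      rw [eB]; exact (Finset.coe_nonempty.2 hB0).convexHull
    unfold polyDim
    rw [direction_affineSpan, direction_affineSpan, direction_affineSpan,
      aux_vectorSpan_add _ _ hFn hGn, ← Submodule.finrank_sup_add_finrank_inf_eq, hbot]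
    simp

end
end

section
/- For any two polytopes P and Q in R^n, there exists a polyhedral subdivision of conv(P ∪ Q) such that every full-dimensional cell C of the subdivision is of the form C = conv(F ∪ G) for a face F of P and a face G of Q with dim(conv(F ∪ G)) = dim(F) + dim(G) + 1 (i.e., C is a join of a face of P and a face of Q). -/
open Pointwise MeasureTheory

noncomputable section

open Classical in
/-- The dimension of a set as an integer, with the convention `dim ∅ = -1`. -/
def polyDimZ {n : ℕ} (P : Set (Fin n → ℝ)) : ℤ :=
  if P = ∅ then -1 else (polyDim P : ℤ)

section Helpers
open Module

theorem farkas_aux {E ι : Type*} [AddCommGroup E] [Module ℝ E] [DecidableEq ι] (s : Finset ι) :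
    ∀ (u : ι → E) (b : E), (∀ h : Dual ℝ E, (∀ i ∈ s, h (u i) ≤ 0) → h b ≤ 0) →
      ∃ l : ι → ℝ, (∀ i, 0 ≤ l i) ∧ b = ∑ i ∈ s, l i • u i := by
  induction s using Finset.induction_on with
  | empty =>
    intro u b H
    refine ⟨0, fun _ => le_rfl, ?_⟩
    simp only [Finset.sum_empty]
    rw [← Module.forall_dual_apply_eq_zero_iff ℝ]
    intro h
    have h1 := H h (by simp)
    have h2 := H (-h) (by simp)
    simp at h2
    linarith
  | insert j s hj ih =>
    intro u b H
    by_cases H' : ∀ h : Dual ℝ E, (∀ i ∈ s, h (u i) ≤ 0) → h b ≤ 0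
    · obtain ⟨l, hl, e⟩ := ih u b H'
      refine ⟨fun i => if i = j then 0 else l i, fun i => by dsimp; split_ifs <;> simp [hl], ?_⟩
      rw [Finset.sum_insert hj, e]
      simp only [if_true, zero_smul, zero_add]
      refine Finset.sum_congr rfl fun i hi => ?_
      rw [if_neg (by rintro rfl; exact hj hi)]
    · push Not at H'
      obtain ⟨g, hg, hgb⟩ := H'
      have hgj : 0 < g (u j) := by
        by_contra hc
        exact absurd (H g (by
          intro i hi
          rcases Finset.mem_insert.1 hi with rfl | hi
          · exact not_lt.1 hc
          · exact hg i hi)) (not_le.2 hgb)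
      obtain ⟨l, hl, e⟩ := ih (fun i => u i - (g (u i) / g (u j)) • u j)
        (b - (g b / g (u j)) • u j) (by
          intro h hh
          have := H (h - (h (u j) / g (u j)) • g) (by
            intro i hi
            rcases Finset.mem_insert.1 hi with rfl | hi
            · simp; field_simp; simp
            · have := hh i hi
              simp at this ⊢
              refine le_trans this (le_of_eq ?_)
              ring)
          simp at this
          simp
          refine le_trans this (le_of_eq ?_)
          ring)
      have hnn : 0 ≤ g b / g (u j) - ∑ i ∈ s, l i * (g (u i) / g (u j)) := by
        have : ∑ i ∈ s, l i * (g (u i) / g (u j)) ≤ 0 :=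
          Finset.sum_nonpos fun i hi =>
            mul_nonpos_of_nonneg_of_nonpos (hl i) (div_nonpos_of_nonpos_of_nonneg (hg i hi) hgj.le)
        have : 0 < g b / g (u j) := by positivity
        linarith
      refine ⟨fun i => if i = j then g b / g (u j) - ∑ i ∈ s, l i * (g (u i) / g (u j)) else l i,
        fun i => by dsimp; split_ifs <;> simp_all, ?_⟩
      rw [Finset.sum_insert hj]
      have e2 : ∑ x ∈ s, (if x = j then g b / g (u j) - ∑ i ∈ s, l i * (g (u i) / g (u j))
          else l x) • u x = ∑ x ∈ s, l x • u x :=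
        Finset.sum_congr rfl fun i hi => by rw [if_neg (by rintro rfl; exact hj hi)]
      simp only [if_true]
      rw [e2]
      rw [sub_eq_iff_eq_add] at e
      refine e.trans ?_
      simp only [smul_sub, Finset.sum_sub_distrib, sub_smul, Finset.sum_smul, mul_smul]
      abel

theorem lp_aux {E ι : Type*} [AddCommGroup E] [Module ℝ E] [Fintype ι] (u : ι → E) (c : ι → ℝ)
    (l : ι → ℝ) (hl : ∀ i, 0 ≤ l i)
    (hmin : ∀ m : ι → ℝ, (∀ i, 0 ≤ m i) → ∑ i, m i • u i = ∑ i, l i • u i →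
      ∑ i, l i * c i ≤ ∑ i, m i * c i) :
    ∃ h : Dual ℝ E, (∀ i, h (u i) ≤ c i) ∧ ∀ i, l i ≠ 0 → h (u i) = c i := by
  classical
  by_contra hcon
  obtain ⟨al, hal, e⟩ := farkas_aux (Finset.univ : Finset (ι ⊕ ι))
    (Sum.elim (fun i => (u i, c i)) (fun i => -(l i • (u i, c i)))) ((0 : E), (-1 : ℝ)) (by
      intro g hg
      by_contra hlt
      apply hcon
      push Not at hlt
      have key : ∀ x t, g (x, t) = g (x, 0) + t * g (0, 1) := by
        intro x t
        rw [← smul_eq_mul, ← map_smul, ← map_add]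
        simp
      set t := g (0, 1) with ht
      have htn : t < 0 := by
        rw [key] at hlt
        have : g ((0 : E), (0 : ℝ)) = 0 := map_zero g
        linarith
      have hle : ∀ i, g (u i, 0) + c i * t ≤ 0 := fun i => by
        have := hg (Sum.inl i) (Finset.mem_univ _)
        rw [← key]; exact this
      refine ⟨(-t)⁻¹ • (g ∘ₗ LinearMap.inl ℝ E ℝ), fun i => ?_, fun i hi => ?_⟩
      · simp only [LinearMap.smul_apply, LinearMap.comp_apply, LinearMap.inl_apply, smul_eq_mul]
        rw [inv_mul_le_iff₀ (by linarith)]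
        linarith [hle i]
      · simp only [LinearMap.smul_apply, LinearMap.comp_apply, LinearMap.inl_apply, smul_eq_mul]
        have h2 := hg (Sum.inr i) (Finset.mem_univ _)
        simp only [Sum.elim_inr, map_neg, map_smul, smul_eq_mul, key (u i) (c i)] at h2
        have hp : 0 < l i := lt_of_le_of_ne (hl i) (Ne.symm hi)
        have h3 : 0 ≤ g (u i, 0) + c i * t := by
          by_contra hc
          push Not at hc
          nlinarith
        rw [inv_mul_eq_iff_eq_mul₀ (by linarith)]
        linarith [hle i])
  simp only [Fintype.sum_sum_type, Sum.elim_inl, Sum.elim_inr] at e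
  have e1 := congrArg Prod.fst e
  have e2 := congrArg Prod.snd e
  simp only [Prod.fst_add, Prod.snd_add, Prod.fst_sum, Prod.snd_sum, Prod.smul_fst, Prod.smul_snd,
    Prod.fst_neg, Prod.snd_neg, smul_eq_mul] at e1 e2
  set B := 1 + ∑ i, al (Sum.inr i) with hB
  have hBi : ∀ i, al (Sum.inr i) ≤ B := fun i => by
    have := Finset.single_le_sum (f := fun i => al (Sum.inr i)) (fun j _ => hal (Sum.inr j))
      (Finset.mem_univ i)
    linarith
  have hBp : 0 < B := by
    have := Finset.sum_nonneg (s := Finset.univ) fun (j : ι) _ => hal (Sum.inr j)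
    linarith
  have hm := hmin (fun i => l i + B⁻¹ * (al (Sum.inl i) - al (Sum.inr i) * l i)) (by
    intro i
    have h1 : B⁻¹ * al (Sum.inr i) ≤ 1 := by
      rw [inv_mul_le_iff₀ hBp]; linarith [hBi i]
    have h2 : 0 ≤ B⁻¹ * al (Sum.inl i) := mul_nonneg (inv_nonneg.2 hBp.le) (hal _)
    nlinarith [hl i]) (by
    simp only [add_smul, Finset.sum_add_distrib, mul_smul, ← Finset.smul_sum, sub_smul,
      Finset.sum_sub_distrib]
    simp only [smul_neg, Finset.sum_neg_distrib] at e1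
    rw [sub_eq_add_neg, ← e1]
    simp)
  have e3 : ∑ i, (l i + B⁻¹ * (al (Sum.inl i) - al (Sum.inr i) * l i)) * c i
      = ∑ i, l i * c i + B⁻¹ * (-1) := by
    rw [e2, ← Finset.sum_add_distrib, Finset.mul_sum, ← Finset.sum_add_distrib]
    refine Finset.sum_congr rfl fun i _ => by ring
  rw [e3] at hm
  have : 0 < B⁻¹ := inv_pos.2 hBp
  linarith

/-- homogenization -/
def hatv {n : ℕ} (x : Fin n → ℝ) : (Fin n → ℝ) × ℝ := (x, 1)

theorem dot_hat {n : ℕ} (f : Dual ℝ ((Fin n → ℝ) × ℝ)) :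
    ∃ (c : Fin n → ℝ) (d : ℝ), ∀ x, f (hatv x) = dotR c x + d := by
  refine ⟨fun i => f (Pi.single i 1, 0), f (0, 1), fun x => ?_⟩
  have h1 : hatv x = LinearMap.inl ℝ _ ℝ x + (0, 1) := by simp [hatv]
  rw [h1, map_add, ← LinearMap.comp_apply, LinearMap.pi_apply_eq_sum_univ]
  simp only [dotR, smul_eq_mul, LinearMap.comp_apply, LinearMap.inl_apply]
  congr 1
  refine Finset.sum_congr rfl fun i _ => ?_
  rw [mul_comm]
  congr 4
  ext j
  simp [Pi.single_apply, eq_comm]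

theorem hat_nonneg {n : ℕ} (f : Dual ℝ ((Fin n → ℝ) × ℝ)) (s : Set (Fin n → ℝ))
    (hs : ∀ x ∈ s, 0 ≤ f (hatv x)) : ∀ x ∈ convexHull ℝ s, 0 ≤ f (hatv x) := by
  have hc : Convex ℝ {x | 0 ≤ f (hatv x)} := by
    intro x hx y hy a b ha hb hab
    have : hatv (a • x + b • y) = a • hatv x + b • hatv y := by
      simp [hatv, hab]
    simp only [Set.mem_ofPred_eq, this, map_add, map_smul, smul_eq_mul] at *
    positivity
  exact fun x hx => convexHull_min hs hc hx

theorem isFace_zero {n : ℕ} (f : Dual ℝ ((Fin n → ℝ) × ℝ)) (K : Set (Fin n → ℝ))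
    (hK : ∀ x ∈ K, 0 ≤ f (hatv x)) : IsFace K {x ∈ K | f (hatv x) = 0} := by
  by_cases he : {x ∈ K | f (hatv x) = 0} = ∅
  · exact Or.inl he
  right
  obtain ⟨z, hz, hz0⟩ := Set.nonempty_iff_ne_empty.2 he
  obtain ⟨c, d, hc⟩ := dot_hat f
  refine ⟨c, ?_⟩
  ext x
  simp only [argminSet, Set.mem_ofPred_eq]
  refine and_congr_right fun hx => ⟨fun h y hy => ?_, fun h => ?_⟩
  · have := hK y hy
    rw [hc] at this h
    linarith
  · have h1 := h z hz
    have h2 := hK x hx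
    rw [hc] at hz0 h2 ⊢
    linarith

theorem face_hull {n : ℕ} (f : Dual ℝ ((Fin n → ℝ) × ℝ)) (s : Set (Fin n → ℝ))
    (hs : ∀ x ∈ s, 0 ≤ f (hatv x)) :
    {x ∈ convexHull ℝ s | f (hatv x) = 0} = convexHull ℝ {x ∈ s | f (hatv x) = 0} := by
  apply Set.Subset.antisymm
  · rintro x ⟨hx, h0⟩
    rw [convexHull_eq] at hx
    obtain ⟨ι, t, w, z, hw, hw1, hz, rfl⟩ := hx
    rw [Finset.centerMass_eq_of_sum_1 _ _ hw1] at h0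
    have h1 : hatv (∑ i ∈ t, w i • z i) = ∑ i ∈ t, w i • hatv (z i) := by
      ext <;> simp [hatv, Prod.fst_sum, Prod.snd_sum, hw1]
    rw [h1, map_sum] at h0
    simp only [map_smul, smul_eq_mul] at h0
    rw [Finset.sum_eq_zero_iff_of_nonneg fun i hi => mul_nonneg (hw i hi) (hs _ (hz i hi))] at h0
    rw [← Finset.centerMass_filter_ne_zero]
    apply Finset.centerMass_mem_convexHull
    · intro i hi; exact hw i (Finset.mem_filter.1 hi).1
    · rw [Finset.sum_filter_ne_zero, hw1]; exact one_pos
    · intro i hi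
      obtain ⟨hi, hne⟩ := Finset.mem_filter.1 hi
      exact ⟨hz i hi, (mul_eq_zero.1 (h0 i hi)).resolve_left hne⟩
  · intro x hx
    refine ⟨convexHull_mono (Set.sep_subset _ _) hx, le_antisymm ?_ ?_⟩
    · have := hat_nonneg (-f) _ (fun y (hy : y ∈ {x ∈ s | f (hatv x) = 0}) => by simp [hy.2]) x hx
      simpa using this
    · exact hat_nonneg f _ hs x (convexHull_mono (Set.sep_subset _ _) hx)

theorem vec_hat {n : ℕ} (S : Set (Fin n → ℝ)) (v : Fin n → ℝ) (hv : v ∈ vectorSpan ℝ S) :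
    (v, (0 : ℝ)) ∈ Submodule.span ℝ (hatv '' S) := by
  rw [vectorSpan] at hv
  have : Submodule.span ℝ (S -ᵥ S) ≤
      (Submodule.span ℝ (hatv '' S)).comap (LinearMap.inl ℝ (Fin n → ℝ) ℝ) := by
    rw [Submodule.span_le]
    rintro _ ⟨x, hx, y, hy, rfl⟩
    have := Submodule.sub_mem _ (Submodule.subset_span (R := ℝ) (Set.mem_image_of_mem hatv hx))
      (Submodule.subset_span (R := ℝ) (Set.mem_image_of_mem hatv hy))
    simpa [hatv] using this
  exact this hv

theorem polyDim_hull {n : ℕ} (S : Set (Fin n → ℝ)) :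
    polyDim (convexHull ℝ S) = polyDim S := by
  rw [polyDim, polyDim, affineSpan_convexHull]

theorem dim_join {n : ℕ} (S T : Set (Fin n → ℝ)) (hS : S.Nonempty) (hT : T.Nonempty)
    (hd : Disjoint (Submodule.span ℝ (hatv '' S)) (Submodule.span ℝ (hatv '' T))) :
    polyDim (S ∪ T) = polyDim S + polyDim T + 1 := by
  obtain ⟨s, hs⟩ := hS
  obtain ⟨t, ht⟩ := hT
  rw [Submodule.disjoint_def] at hd
  have hs' := Submodule.subset_span (R := ℝ) (Set.mem_image_of_mem hatv hs)
  have ht' := Submodule.subset_span (R := ℝ) (Set.mem_image_of_mem hatv ht)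
  unfold polyDim
  rw [AffineSubspace.span_union, AffineSubspace.direction_sup (mem_affineSpan ℝ hs)
    (mem_affineSpan ℝ ht), direction_affineSpan, direction_affineSpan]
  have d1 : Disjoint (vectorSpan ℝ S) (vectorSpan ℝ T) := by
    rw [Submodule.disjoint_def]
    intro v h1 h2
    exact congrArg Prod.fst (hd _ (vec_hat S v h1) (vec_hat T v h2))
  have d2 : Disjoint (vectorSpan ℝ S ⊔ vectorSpan ℝ T) (Submodule.span ℝ {t -ᵥ s}) := by
    rw [Submodule.disjoint_def]
    intro v h1 h2
    obtain ⟨r, rfl⟩ := Submodule.mem_span_singleton.1 h2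
    obtain ⟨a, ha, b, hb, e⟩ := Submodule.mem_sup.1 h1
    have m1 := Submodule.add_mem _ (vec_hat S a ha) (Submodule.smul_mem _ r hs')
    have m2 := Submodule.sub_mem _ (Submodule.smul_mem _ r ht') (vec_hat T b hb)
    have e2 : (a, (0 : ℝ)) + r • hatv s = r • hatv t - (b, (0 : ℝ)) := by
      have e' : a = r • t - r • s - b := by
        rw [eq_sub_iff_add_eq, e, vsub_eq_sub, smul_sub]
      ext <;> simp [hatv, e']
      ring
    rw [← e2] at m2
    have := congrArg Prod.snd (hd _ m1 m2)
    simp [hatv] at this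
    simp [this]
  have f1 := Submodule.finrank_sup_add_finrank_inf_eq (vectorSpan ℝ S) (vectorSpan ℝ T)
  have f2 := Submodule.finrank_sup_add_finrank_inf_eq (vectorSpan ℝ S ⊔ vectorSpan ℝ T)
    (Submodule.span ℝ {t -ᵥ s})
  rw [d1.eq_bot, finrank_bot] at f1
  rw [d2.eq_bot, finrank_bot, finrank_span_singleton] at f2
  · omega
  · intro h0
    rw [vsub_eq_sub, sub_eq_zero] at h0
    rw [h0] at ht'
    have := congrArg Prod.snd (hd _ hs' ht')
    simp [hatv] at this

end Helpers

/-- The convex hull `conv(P ∪ Q)` of two polytopes admits a subdivision in which every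
full-dimensional cell is a join `conv(F ∪ G)` of a face `F` of `P` and a face `G` of `Q`
(i.e. `dim conv(F ∪ G) = dim F + dim G + 1`, with the convention `dim ∅ = -1`). -/
theorem subdivision_of_convex_hull_into_joins {n : ℕ}
    (P Q : Set (Fin n → ℝ)) (hP : IsPolytope P) (hQ : IsPolytope Q) :
    ∃ 𝒞 : Finset (Set (Fin n → ℝ)), IsSubdivision (convexHull ℝ (P ∪ Q)) 𝒞 ∧
      ∀ C ∈ 𝒞, polyDim C = polyDim (convexHull ℝ (P ∪ Q)) →
        ∃ F G : Set (Fin n → ℝ), IsFace P F ∧ IsFace Q G ∧ C = convexHull ℝ (F ∪ G) ∧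
          polyDimZ (convexHull ℝ (F ∪ G)) = polyDimZ F + polyDimZ G + 1 := by
  classical
  obtain ⟨V, hVn, rfl⟩ := hP
  obtain ⟨W, hWn, rfl⟩ := hQ
  -- generic lifting functional
  obtain ⟨a, ha⟩ : ∃ a : Module.Dual ℝ ((Fin n → ℝ) × ℝ), ∀ S T : Set (Fin n → ℝ),
      S ⊆ V → T ⊆ W →
      (∀ w ∈ Submodule.span ℝ (hatv '' S) ⊓ Submodule.span ℝ (hatv '' T), a w = 0) →
      Disjoint (Submodule.span ℝ (hatv '' S)) (Submodule.span ℝ (hatv '' T)) := by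
    let J := {p : V.powerset × W.powerset //
      Submodule.span ℝ (hatv '' (p.1.1 : Set (Fin n → ℝ))) ⊓
        Submodule.span ℝ (hatv '' (p.2.1 : Set (Fin n → ℝ))) ≠ ⊥}
    have hJ : ∀ j : J, ∃ w ∈ Submodule.span ℝ (hatv '' (j.1.1.1 : Set (Fin n → ℝ))) ⊓
        Submodule.span ℝ (hatv '' (j.1.2.1 : Set (Fin n → ℝ))), w ≠ 0 :=
      fun j => Submodule.exists_mem_ne_zero_of_ne_bot j.2
    choose w hw hw0 using hJ
    obtain ⟨a, ha⟩ := Module.exists_dual_forall_apply_ne_zero (K := ℝ) w hw0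
    refine ⟨a, fun S T hS hT h => ?_⟩
    rw [disjoint_iff]
    by_contra hne
    have hSf : S.Finite := V.finite_toSet.subset hS
    have hTf : T.Finite := W.finite_toSet.subset hT
    let j : J := ⟨(⟨hSf.toFinset, by simpa [Finset.mem_powerset] using hS⟩,
      ⟨hTf.toFinset, by simpa [Finset.mem_powerset] using hT⟩), by simpa using hne⟩
    have h1 := hw j
    simp only [j, Set.Finite.coe_toFinset] at h1
    exact ha j (h _ h1)
  let ι := V ⊕ W
  let u : ι → Fin n → ℝ := Sum.elim (fun v => v.1) (fun w => w.1)
  let c : ι → ℝ := Sum.elim (fun v => a (hatv v.1)) (fun _ => 0)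
  let A : Module.Dual ℝ ((Fin n → ℝ) × ℝ) → Set (Fin n → ℝ) :=
    fun h => u '' {i | h (hatv (u i)) = c i}
  let Feas : Module.Dual ℝ ((Fin n → ℝ) × ℝ) → Prop := fun h => ∀ i, h (hatv (u i)) ≤ c i
  let cells : Set (Set (Fin n → ℝ)) := {C | ∃ h, Feas h ∧ (A h).Nonempty ∧ C = convexHull ℝ (A h)}
  have hfin : cells.Finite := by
    refine (Set.finite_range fun t : Set ι => convexHull ℝ (u '' t)).subset ?_
    rintro C ⟨h, -, -, rfl⟩
    exact ⟨_, rfl⟩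
  have hAf : ∀ h, (A h).Finite := fun h => Set.toFinite _
  have hrange : Set.range u = (V : Set (Fin n → ℝ)) ∪ W := by
    rw [Set.Sum.elim_range]
    simp
  have hR : convexHull ℝ (convexHull ℝ (V : Set (Fin n → ℝ)) ∪ convexHull ℝ (W : Set (Fin n → ℝ)))
      = convexHull ℝ (Set.range u) := by
    rw [convexHull_convexHull_union_left, convexHull_convexHull_union_right, hrange]
  -- intersections
  have hinter : ∀ h k, Feas h → Feas k → IsFace (convexHull ℝ (A h))
      (convexHull ℝ (A h) ∩ convexHull ℝ (A k)) := by
    intro h k hh hk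
    have hnn : ∀ h k, Feas h → Feas k → ∀ x ∈ A h, 0 ≤ (h - k) (hatv x) := by
      rintro h k hh hk _ ⟨i, hi, rfl⟩
      have h1 := hk i
      have h2 : h (hatv (u i)) = c i := hi
      simp only [LinearMap.sub_apply]
      linarith
    have : convexHull ℝ (A h) ∩ convexHull ℝ (A k)
        = {x ∈ convexHull ℝ (A h) | (h - k) (hatv x) = 0} := by
      apply Set.Subset.antisymm
      · rintro x ⟨hx, hx'⟩
        refine ⟨hx, ?_⟩
        have h1 := hat_nonneg _ _ (hnn h k hh hk) x hx
        have h2 := hat_nonneg _ _ (hnn k h hk hh) x hx'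
        simp only [LinearMap.sub_apply] at h1 h2 ⊢
        linarith
      · rintro x hx
        refine ⟨hx.1, ?_⟩
        rw [face_hull _ _ (hnn h k hh hk)] at hx
        refine convexHull_mono ?_ hx
        rintro _ ⟨⟨i, hi, rfl⟩, h0⟩
        refine ⟨i, ?_, rfl⟩
        have h2 : h (hatv (u i)) = c i := hi
        simp only [LinearMap.sub_apply] at h0
        show k (hatv (u i)) = c i
        linarith
    rw [this]
    exact isFace_zero _ _ (hat_nonneg _ _ (hnn h k hh hk))
  refine ⟨hfin.toFinset, ⟨?_, ?_, ?_⟩, ?_⟩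
  · intro C hC
    obtain ⟨h, hh, hne, rfl⟩ := hfin.mem_toFinset.1 hC
    exact ⟨(hAf h).toFinset, by simpa using hne, by simp⟩
  · rw [hR]
    apply Set.Subset.antisymm
    · refine Set.iUnion₂_subset fun C hC => ?_
      obtain ⟨h, hh, hne, rfl⟩ := hfin.mem_toFinset.1 hC
      exact convexHull_mono (Set.image_subset_range _ _)
    · intro x hx
      have hx' : ∃ l ∈ stdSimplex ℝ ι, ∑ i, l i • u i = x := by
        rw [mem_convexHull_iff_exists_fintype] at hx
        obtain ⟨κ, _, w, z, hw, hw1, hz, rfl⟩ := hx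
        choose g hg using hz
        refine ⟨fun i => ∑ k with g k = i, w k, ⟨fun i => Finset.sum_nonneg fun k _ => hw k, ?_⟩, ?_⟩
        · rw [Finset.sum_fiberwise, hw1]
        · simp_rw [Finset.sum_smul]
          rw [← Finset.sum_fiberwise (s := Finset.univ) (g := g)]
          refine Finset.sum_congr rfl fun i _ => Finset.sum_congr rfl fun k hk => ?_
          rw [← hg k, (Finset.mem_filter.1 hk).2]
      obtain ⟨l0, hl0, hl0x⟩ := hx'
      have hcomp : IsCompact {l ∈ stdSimplex ℝ ι | ∑ i, l i • u i = x} := by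
        refine (isCompact_stdSimplex ℝ ι).inter_right ?_
        exact isClosed_eq (by fun_prop) continuous_const
      obtain ⟨l, ⟨hl, hlx⟩, hlm⟩ := hcomp.exists_isMinOn ⟨l0, hl0, hl0x⟩
        (f := fun l => ∑ i, l i * c i) (by fun_prop)
      have hsum : ∀ m : ι → ℝ, ∑ i, m i • hatv (u i) = (∑ i, m i • u i, ∑ i, m i) := by
        intro m
        ext <;> simp [hatv, Prod.fst_sum, Prod.snd_sum]
      obtain ⟨h, h1, h2⟩ := lp_aux (fun i => hatv (u i)) c l hl.1 (by
        intro m hm e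
        rw [hsum, hsum, Prod.mk.injEq] at e
        exact hlm ⟨⟨hm, e.2.trans hl.2⟩, e.1.trans hlx⟩)
      have hxA : x ∈ convexHull ℝ (A h) := by
        rw [← hlx, ← Finset.centerMass_eq_of_sum_1 _ _ hl.2, ← Finset.centerMass_filter_ne_zero]
        apply Finset.centerMass_mem_convexHull
        · intro i _; exact hl.1 i
        · rw [Finset.sum_filter_ne_zero, hl.2]; exact one_pos
        · intro i hi
          exact ⟨i, h2 i (Finset.mem_filter.1 hi).2, rfl⟩
      refine Set.mem_iUnion₂.2 ⟨convexHull ℝ (A h), hfin.mem_toFinset.2 ⟨h, h1, ?_, rfl⟩, hxA⟩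
      exact convexHull_nonempty_iff.1 ⟨x, hxA⟩
  · intro C hC D hD
    obtain ⟨h, hh, hne, rfl⟩ := hfin.mem_toFinset.1 hC
    obtain ⟨k, hk, hne', rfl⟩ := hfin.mem_toFinset.1 hD
    exact ⟨hinter h k hh hk, by rw [Set.inter_comm]; exact hinter k h hk hh⟩
  · intro C hC _
    obtain ⟨h, hh, hne, rfl⟩ := hfin.mem_toFinset.1 hC
    let S : Set (Fin n → ℝ) := {x ∈ (V : Set (Fin n → ℝ)) | (a - h) (hatv x) = 0}
    let T : Set (Fin n → ℝ) := {x ∈ (W : Set (Fin n → ℝ)) | (-h) (hatv x) = 0}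
    have hS : ∀ x ∈ (V : Set (Fin n → ℝ)), 0 ≤ (a - h) (hatv x) := by
      intro x hx
      have := hh (Sum.inl ⟨x, hx⟩)
      simpa [u, c] using this
    have hT : ∀ x ∈ (W : Set (Fin n → ℝ)), 0 ≤ (-h) (hatv x) := by
      intro x hx
      have := hh (Sum.inr ⟨x, hx⟩)
      simpa [u, c] using this
    have hA : A h = S ∪ T := by
      ext x
      constructor
      · rintro ⟨i | i, hi, rfl⟩
        · left
          refine ⟨i.2, ?_⟩
          have : h (hatv i.1) = a (hatv i.1) := hi
          simp [u, this]
        · right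
          refine ⟨i.2, ?_⟩
          have : h (hatv i.1) = 0 := hi
          simp [u, this]
      · rintro (⟨hx, h0⟩ | ⟨hx, h0⟩)
        · refine ⟨Sum.inl ⟨x, hx⟩, ?_, rfl⟩
          show h (hatv x) = a (hatv x)
          simp only [LinearMap.sub_apply] at h0
          linarith
        · refine ⟨Sum.inr ⟨x, hx⟩, ?_, rfl⟩
          show h (hatv x) = 0
          simpa using h0
    have hdisj : Disjoint (Submodule.span ℝ (hatv '' S)) (Submodule.span ℝ (hatv '' T)) := by
      apply ha S T (Set.sep_subset _ _) (Set.sep_subset _ _)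
      rintro w ⟨h1, h2⟩
      have k1 : Submodule.span ℝ (hatv '' S) ≤ LinearMap.ker (a - h) := by
        rw [Submodule.span_le]
        rintro _ ⟨x, hx, rfl⟩
        exact hx.2
      have k2 : Submodule.span ℝ (hatv '' T) ≤ LinearMap.ker (-h) := by
        rw [Submodule.span_le]
        rintro _ ⟨x, hx, rfl⟩
        exact hx.2
      have e1 := LinearMap.mem_ker.1 (k1 h1)
      have e2 := LinearMap.mem_ker.1 (k2 h2)
      simp only [LinearMap.sub_apply, LinearMap.neg_apply] at e1 e2
      linarith
    refine ⟨convexHull ℝ S, convexHull ℝ T, ?_, ?_, ?_, ?_⟩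
    · rw [← face_hull _ _ hS]
      exact isFace_zero _ _ (hat_nonneg _ _ hS)
    · rw [← face_hull _ _ hT]
      exact isFace_zero _ _ (hat_nonneg _ _ hT)
    · rw [convexHull_convexHull_union_left, convexHull_convexHull_union_right, hA]
    · rw [convexHull_convexHull_union_left, convexHull_convexHull_union_right]
      unfold polyDimZ
      simp only [convexHull_eq_empty, polyDim_hull, Set.union_empty_iff]
      by_cases hSe : S = ∅
      · by_cases hTe : T = ∅
        · simp [hSe, hTe]
        · simp [hSe, hTe]
      · by_cases hTe : T = ∅
        · simp [hSe, hTe]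
        · simp only [hSe, hTe, if_false, false_and]
          rw [dim_join S T (Set.nonempty_iff_ne_empty.2 hSe) (Set.nonempty_iff_ne_empty.2 hTe) hdisj]
          push_cast
          ring

end
end
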